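/- arXiv:2310.07340 — 2 statements merged into one kernel-verified Lean document; each statement's English description precedes it below -/
import Mathlib

section
/- (Cartan's closedness theorem for ideals, special case) Let I be an ideal of the ring 𝒪_n of germs of holomorphic functions at 0 ∈ ℂⁿ generated by g₁, …, g_m, let V be a polydisc neighbourhood of 0, and let (h_k) be a sequence of holomorphic functions on V whose germs at 0 lie in I, converging uniformly on compact subsets of V to a holomorphic function h. Then the germ of h at 0 lies in I. -/
open Filter Metric Set Topology

/-- `MemIdealGerm g h` : the germ at `0` of `h` lies in the ideal of the ring of holomorphic
germs at `0 ∈ ℂⁿ` generated by the germs of `g 0, …, g (m-1)`; concretely, `h` agrees near `0`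
with a combination `Σ aⱼ·gⱼ` with holomorphic germ coefficients `aⱼ`. -/
def MemIdealGerm {n m : ℕ} (g : Fin m → ((Fin n → ℂ) → ℂ)) (h : (Fin n → ℂ) → ℂ) : Prop :=
  ∃ a : Fin m → ((Fin n → ℂ) → ℂ), (∀ j, AnalyticAt ℂ (a j) 0) ∧
    ∀ᶠ z in 𝓝 (0 : Fin n → ℂ), h z = ∑ j, a j z * g j z

noncomputable section CartanAux

open scoped ENNReal
/-- primes attached to variables -/
def cpr {n : ℕ} (i : Fin n) : ℕ := Nat.nth Nat.Prime i

lemma cpr_prime {n : ℕ} (i : Fin n) : (cpr i).Prime := Nat.prime_nth_prime i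

lemma cpr_inj {n : ℕ} : Function.Injective (cpr : Fin n → ℕ) := by
  intro i j h
  exact Fin.ext (Nat.nth_injective Nat.infinite_setOfPred_prime h)

/-- the integer attached to a multi-exponent -/
def cNN {n : ℕ} (β : Fin n →₀ ℕ) : ℕ := ∏ i, cpr i ^ β i

lemma cNN_add {n : ℕ} (a b : Fin n →₀ ℕ) : cNN (a + b) = cNN a * cNN b := by
  simp [cNN, pow_add, Finset.prod_mul_distrib]

lemma cNN_pos {n : ℕ} (a : Fin n →₀ ℕ) : 0 < cNN a :=
  Finset.prod_pos fun i _ => pow_pos (cpr_prime i).pos _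

lemma cNN_fact {n : ℕ} (a : Fin n →₀ ℕ) (i : Fin n) : (cNN a).factorization (cpr i) = a i := by
  rw [cNN, Nat.factorization_prod (fun j _ => (pow_pos (cpr_prime j).pos _).ne')]
  simp only [Finset.sum_apply', (cpr_prime _).factorization_pow, Finsupp.single_apply]
  rw [Finset.sum_eq_single i]
  · simp
  · intro j _ hj
    rw [if_neg (fun h => hj (cpr_inj h))]
  · simp

lemma cNN_inj {n : ℕ} : Function.Injective (cNN : (Fin n →₀ ℕ) → ℕ) := by
  intro a b h
  ext i
  rw [← cNN_fact a, ← cNN_fact b, h]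

lemma cNN_finite {n : ℕ} (K : ℕ) : {β : Fin n →₀ ℕ | cNN β < K}.Finite :=
  (Set.finite_lt_nat K).preimage cNN_inj.injOn

/-- weights -/
def cw {n : ℕ} (s : ℕ) (β : Fin n →₀ ℕ) : ℝ≥0∞ := ((cNN β : ℝ≥0∞) ^ s)⁻¹

lemma cNN_ne_zero {n : ℕ} (a : Fin n →₀ ℕ) : (cNN a : ℝ≥0∞) ≠ 0 := by
  exact_mod_cast (cNN_pos a).ne'

lemma cw_ne_top {n : ℕ} (s : ℕ) (a : Fin n →₀ ℕ) : cw s a ≠ ⊤ := by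
  simp [cw, (cNN_pos a).ne']

lemma cw_ne_zero {n : ℕ} (s : ℕ) (a : Fin n →₀ ℕ) : cw s a ≠ 0 := by
  simp [cw]

lemma cw_add {n : ℕ} (s : ℕ) (a b : Fin n →₀ ℕ) : cw s (a + b) = cw s a * cw s b := by
  rw [cw, cw, cw, cNN_add, Nat.cast_mul, mul_pow,
    ENNReal.mul_inv (Or.inl (pow_ne_zero _ (cNN_ne_zero a)))
      (Or.inl (ENNReal.pow_ne_top (ENNReal.natCast_ne_top _)))]

lemma cw_exp_add {n : ℕ} (s t : ℕ) (a : Fin n →₀ ℕ) : cw (s + t) a = cw s a * cw t a := by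
  rw [cw, cw, cw, pow_add,
    ENNReal.mul_inv (Or.inl (pow_ne_zero _ (cNN_ne_zero a)))
      (Or.inl (ENNReal.pow_ne_top (ENNReal.natCast_ne_top _)))]

lemma cw_anti {n : ℕ} {s t : ℕ} (h : s ≤ t) (a : Fin n →₀ ℕ) : cw t a ≤ cw s a := by
  rw [cw, cw, ENNReal.inv_le_inv]
  exact pow_le_pow_right₀ (by exact_mod_cast cNN_pos a) h

/-- weighted l1 norm -/
def cnrm {n : ℕ} (s : ℕ) (f : MvPowerSeries (Fin n) ℂ) : ℝ≥0∞ :=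
  ∑' β, ‖MvPowerSeries.coeff β f‖ₑ * cw s β

/-- convergent power series -/
def CConv {n : ℕ} (f : MvPowerSeries (Fin n) ℂ) : Prop := ∃ s, cnrm s f ≠ ⊤

lemma cnrm_anti {n : ℕ} {s t : ℕ} (h : s ≤ t) (f : MvPowerSeries (Fin n) ℂ) :
    cnrm t f ≤ cnrm s f :=
  ENNReal.tsum_le_tsum fun β => mul_le_mul_right (cw_anti h β) _

lemma cnrm_zero {n : ℕ} (s : ℕ) : cnrm s (0 : MvPowerSeries (Fin n) ℂ) = 0 := by
  simp [cnrm]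

lemma cnrm_neg {n : ℕ} (s : ℕ) (f : MvPowerSeries (Fin n) ℂ) : cnrm s (-f) = cnrm s f := by
  simp [cnrm]

lemma cnrm_add_le {n : ℕ} (s : ℕ) (f g : MvPowerSeries (Fin n) ℂ) :
    cnrm s (f + g) ≤ cnrm s f + cnrm s g := by
  rw [cnrm, cnrm, cnrm, ← ENNReal.tsum_add]
  refine ENNReal.tsum_le_tsum fun β => ?_
  rw [← add_mul, map_add]
  exact mul_le_mul_left (enorm_add_le _ _) _

lemma cnrm_sum_le {n : ℕ} {ι : Type*} (s : ℕ) (A : Finset ι) (f : ι → MvPowerSeries (Fin n) ℂ) :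
    cnrm s (∑ i ∈ A, f i) ≤ ∑ i ∈ A, cnrm s (f i) := by
  classical
  induction A using Finset.induction_on with
  | empty => simp [cnrm_zero]
  | insert a A ha ih =>
    rw [Finset.sum_insert ha, Finset.sum_insert ha]
    exact (cnrm_add_le _ _ _).trans (by gcongr)

lemma cnrm_mul_le {n : ℕ} (s : ℕ) (f g : MvPowerSeries (Fin n) ℂ) :
    cnrm s (f * g) ≤ cnrm s f * cnrm s g := by
  classical
  have h1 : cnrm s f * cnrm s g = ∑' p : (Fin n →₀ ℕ) × (Fin n →₀ ℕ),
      (‖MvPowerSeries.coeff p.1 f‖ₑ * cw s p.1) * (‖MvPowerSeries.coeff p.2 g‖ₑ * cw s p.2) := by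
    rw [ENNReal.tsum_prod', cnrm, cnrm, ← ENNReal.tsum_mul_right]
    refine tsum_congr fun a => ?_
    rw [← ENNReal.tsum_mul_left]
  rw [h1, ← Finset.HasAntidiagonal.sigmaAntidiagonalEquivProd.tsum_eq, ENNReal.tsum_sigma', cnrm]
  refine ENNReal.tsum_le_tsum fun β => ?_
  rw [MvPowerSeries.coeff_mul, tsum_fintype]
  simp only [Finset.HasAntidiagonal.sigmaAntidiagonalEquivProd_apply]
  rw [Finset.sum_coe_sort (Finset.HasAntidiagonal.antidiagonal β) (fun p => (‖MvPowerSeries.coeff p.1 f‖ₑ * cw s p.1) * (‖MvPowerSeries.coeff p.2 g‖ₑ * cw s p.2))]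
  calc _ ≤ (∑ p ∈ Finset.HasAntidiagonal.antidiagonal β, ‖MvPowerSeries.coeff p.1 f * MvPowerSeries.coeff p.2 g‖ₑ) * cw s β :=
        mul_le_mul_left (enorm_sum_le _ _) _
    _ = _ := by
        rw [Finset.sum_mul]
        refine Finset.sum_congr rfl fun p hp => ?_
        rw [← Finset.HasAntidiagonal.mem_antidiagonal.1 hp, cw_add, enorm_mul]
        ring

lemma CConv.add {n : ℕ} {f g : MvPowerSeries (Fin n) ℂ} (hf : CConv f) (hg : CConv g) :
    CConv (f + g) := by
  obtain ⟨s, hs⟩ := hf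
  obtain ⟨t, ht⟩ := hg
  refine ⟨max s t, ne_top_of_le_ne_top (ENNReal.add_ne_top.2 ⟨hs, ht⟩)
    ((cnrm_add_le _ _ _).trans (add_le_add (cnrm_anti (le_max_left _ _) _) (cnrm_anti (le_max_right _ _) _)))⟩

lemma CConv.mul {n : ℕ} {f g : MvPowerSeries (Fin n) ℂ} (hf : CConv f) (hg : CConv g) :
    CConv (f * g) := by
  obtain ⟨s, hs⟩ := hf
  obtain ⟨t, ht⟩ := hg
  refine ⟨max s t, ne_top_of_le_ne_top (ENNReal.mul_ne_top hs ht)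
    ((cnrm_mul_le _ _ _).trans (mul_le_mul' (cnrm_anti (le_max_left _ _) _) (cnrm_anti (le_max_right _ _) _)))⟩

lemma CConv.neg {n : ℕ} {f : MvPowerSeries (Fin n) ℂ} (hf : CConv f) : CConv (-f) := by
  obtain ⟨s, hs⟩ := hf
  exact ⟨s, by rwa [cnrm_neg]⟩

lemma CConv.sub {n : ℕ} {f g : MvPowerSeries (Fin n) ℂ} (hf : CConv f) (hg : CConv g) :
    CConv (f - g) := by
  rw [sub_eq_add_neg]; exact hf.add hg.neg

lemma CConv.zero {n : ℕ} : CConv (0 : MvPowerSeries (Fin n) ℂ) := ⟨0, by simp [cnrm_zero]⟩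

lemma CConv.sum {n : ℕ} {ι : Type*} {A : Finset ι} {f : ι → MvPowerSeries (Fin n) ℂ}
    (hf : ∀ i ∈ A, CConv (f i)) : CConv (∑ i ∈ A, f i) :=
  Finset.sum_induction _ _ (fun _ _ h1 h2 => h1.add h2) CConv.zero hf

lemma CConv.monomial {n : ℕ} (α : Fin n →₀ ℕ) (c : ℂ) :
    CConv (MvPowerSeries.monomial α c) := by
  classical
  refine ⟨0, ?_⟩
  rw [cnrm, tsum_eq_single α]
  · exact ENNReal.mul_ne_top enorm_ne_top (cw_ne_top _ _)
  · intro β hβ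
    simp [MvPowerSeries.coeff_monomial, hβ]

/-- tail estimate -/
lemma cnrm_tail {n : ℕ} {f : MvPowerSeries (Fin n) ℂ} (hf : CConv f) (α : Fin n →₀ ℕ)
    (h0 : ∀ β, cNN β ≤ cNN α → MvPowerSeries.coeff β f = 0) {ε : ℝ≥0∞} (hε : 0 < ε) :
    ∀ᶠ s in atTop, cnrm s f ≤ ε * cw s α := by
  obtain ⟨s0, hs0⟩ := hf
  set a : ℝ≥0∞ := (cNN α : ℝ≥0∞) with ha
  have ha0 : a ≠ 0 := cNN_ne_zero α
  have hat : a ≠ ⊤ := ENNReal.natCast_ne_top _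
  have hb0 : a + 1 ≠ 0 := by simp
  have hbt : a + 1 ≠ ⊤ := by simp [hat]
  have h1 : ∀ u, cnrm (s0 + u) f ≤ cnrm s0 f * ((a + 1) ^ u)⁻¹ := by
    intro u
    rw [cnrm, cnrm, ← ENNReal.tsum_mul_right]
    refine ENNReal.tsum_le_tsum fun β => ?_
    by_cases hβ : cNN β ≤ cNN α
    · simp [h0 β hβ]
    · rw [cw_exp_add, ← mul_assoc]
      refine mul_le_mul_right ?_ _
      rw [cw, ENNReal.inv_le_inv]
      refine pow_le_pow_left' ?_ _
      rw [ha]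
      exact_mod_cast Nat.succ_le_of_lt (not_le.1 hβ)
  have hlt : a * (a + 1)⁻¹ < 1 := by
    rw [← div_eq_mul_inv, ENNReal.div_lt_iff (Or.inl hb0) (Or.inl hbt), one_mul]
    exact ENNReal.lt_add_right hat one_ne_zero
  have ht : Tendsto (fun u => cnrm s0 f * a ^ s0 * (a * (a + 1)⁻¹) ^ u) atTop (𝓝 0) := by
    have := ENNReal.Tendsto.const_mul (a := cnrm s0 f * a ^ s0) (ENNReal.tendsto_pow_atTop_nhds_zero_of_lt_one hlt)
      (Or.inr (ENNReal.mul_ne_top hs0 (ENNReal.pow_ne_top hat)))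
    simpa using this
  have he : ∀ᶠ u in atTop, cnrm s0 f * a ^ s0 * (a * (a + 1)⁻¹) ^ u < ε := ht.eventually_lt_const hε
  obtain ⟨U, hU⟩ := eventually_atTop.1 he
  refine eventually_atTop.2 ⟨s0 + U, fun s hs => ?_⟩
  obtain ⟨u, rfl⟩ := Nat.exists_eq_add_of_le (show s0 ≤ s by omega)
  have h2 := hU u (by omega)
  refine (h1 u).trans ?_
  have h3 : a ^ (s0 + u) * cw (s0 + u) α = 1 := by
    rw [cw, ← ha]
    exact ENNReal.mul_inv_cancel (pow_ne_zero _ ha0) (ENNReal.pow_ne_top hat)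
  calc cnrm s0 f * ((a + 1) ^ u)⁻¹ = cnrm s0 f * ((a + 1) ^ u)⁻¹ * (a ^ (s0 + u) * cw (s0 + u) α) := by
        rw [h3, mul_one]
    _ = (cnrm s0 f * a ^ s0 * (a * (a + 1)⁻¹) ^ u) * cw (s0 + u) α := by
        rw [mul_pow, ENNReal.inv_pow, pow_add]; ring
    _ ≤ _ := mul_le_mul_left h2.le _

end CartanAux
noncomputable section CartanAux2
open scoped ENNReal

/-- partial quotient -/
def cq {n : ℕ} (j : (Fin n →₀ ℕ) → (Fin n →₀ ℕ)) (α : Fin n →₀ ℕ) (f : MvPowerSeries (Fin n) ℂ) :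
    MvPowerSeries (Fin n) ℂ :=
  open Classical in fun δ => if j (δ + α) = α then MvPowerSeries.coeff (δ + α) f else 0

lemma coeff_cq {n : ℕ} (j : (Fin n →₀ ℕ) → (Fin n →₀ ℕ)) (α δ : Fin n →₀ ℕ)
    (f : MvPowerSeries (Fin n) ℂ) [Decidable (j (δ + α) = α)] :
    MvPowerSeries.coeff δ (cq j α f) =
      if j (δ + α) = α then MvPowerSeries.coeff (δ + α) f else 0 := by
  show cq j α f δ = _
  unfold cq
  congr

lemma cq_add {n : ℕ} (j : (Fin n →₀ ℕ) → (Fin n →₀ ℕ)) (α : Fin n →₀ ℕ)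
    (f g : MvPowerSeries (Fin n) ℂ) : cq j α (f + g) = cq j α f + cq j α g := by
  classical
  ext δ
  rw [map_add, coeff_cq, coeff_cq, coeff_cq, map_add]
  split_ifs <;> simp

lemma cq_norm {n : ℕ} (j : (Fin n →₀ ℕ) → (Fin n →₀ ℕ)) (A : Finset (Fin n →₀ ℕ))
    (f : MvPowerSeries (Fin n) ℂ) (s : ℕ) :
    ∑ α ∈ A, cnrm s (cq j α f) * cw s α ≤ cnrm s f := by
  classical
  have h1 : ∀ α, cnrm s (cq j α f) * cw s α ≤
      ∑' β, if j β = α then ‖MvPowerSeries.coeff β f‖ₑ * cw s β else 0 := by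
    intro α
    rw [cnrm, ← ENNReal.tsum_mul_right]
    refine le_trans (ENNReal.tsum_le_tsum fun δ => ?_)
      (ENNReal.tsum_comp_le_tsum_of_injective (f := fun δ : Fin n →₀ ℕ => δ + α)
        (add_left_injective α) _)
    simp only [coeff_cq]
    split_ifs
    · rw [cw_add, mul_assoc]
    · simp
  calc _ ≤ ∑ α ∈ A, ∑' β, (if j β = α then ‖MvPowerSeries.coeff β f‖ₑ * cw s β else 0) :=
        Finset.sum_le_sum fun α _ => h1 α
    _ = ∑' β, ∑ α ∈ A, (if j β = α then ‖MvPowerSeries.coeff β f‖ₑ * cw s β else 0) :=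
        (Summable.tsum_finsetSum (fun _ _ => ENNReal.summable)).symm
    _ ≤ _ := by
        refine ENNReal.tsum_le_tsum fun β => ?_
        rw [Finset.sum_ite_eq]
        split_ifs <;> simp

lemma cq_norm_single {n : ℕ} (j : (Fin n →₀ ℕ) → (Fin n →₀ ℕ)) (α : Fin n →₀ ℕ)
    {f : MvPowerSeries (Fin n) ℂ} {s : ℕ} (hf : cnrm s f ≠ ⊤) : cnrm s (cq j α f) ≠ ⊤ := by
  have := cq_norm j {α} f s
  rw [Finset.sum_singleton] at this
  intro h
  rw [h, ENNReal.top_mul (cw_ne_zero _ _)] at this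
  exact hf (top_le_iff.1 this)

/-- the division operator -/
def cT {n : ℕ} (j : (Fin n →₀ ℕ) → (Fin n →₀ ℕ)) (A : Finset (Fin n →₀ ℕ))
    (t : (Fin n →₀ ℕ) → MvPowerSeries (Fin n) ℂ) (f : MvPowerSeries (Fin n) ℂ) :
    MvPowerSeries (Fin n) ℂ := -∑ α ∈ A, cq j α f * t α

lemma cT_add {n : ℕ} (j : (Fin n →₀ ℕ) → (Fin n →₀ ℕ)) (A : Finset (Fin n →₀ ℕ))
    (t : (Fin n →₀ ℕ) → MvPowerSeries (Fin n) ℂ) (f g : MvPowerSeries (Fin n) ℂ) :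
    cT j A t (f + g) = cT j A t f + cT j A t g := by
  simp only [cT, cq_add, add_mul, Finset.sum_add_distrib]
  ring

lemma cT_norm {n : ℕ} (j : (Fin n →₀ ℕ) → (Fin n →₀ ℕ)) (A : Finset (Fin n →₀ ℕ))
    (t : (Fin n →₀ ℕ) → MvPowerSeries (Fin n) ℂ) {s : ℕ} {ε : ℝ≥0∞}
    (ht : ∀ α ∈ A, cnrm s (t α) ≤ ε * cw s α)
    (f : MvPowerSeries (Fin n) ℂ) : cnrm s (cT j A t f) ≤ ε * cnrm s f := by
  rw [cT, cnrm_neg]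
  calc _ ≤ ∑ α ∈ A, cnrm s (cq j α f * t α) := cnrm_sum_le _ _ _
    _ ≤ ∑ α ∈ A, ε * (cnrm s (cq j α f) * cw s α) := by
        refine Finset.sum_le_sum fun α hα => (cnrm_mul_le _ _ _).trans ?_
        calc _ ≤ cnrm s (cq j α f) * (ε * cw s α) := mul_le_mul_right (ht α hα) _
          _ = _ := by ring
    _ = ε * ∑ α ∈ A, cnrm s (cq j α f) * cw s α := by rw [Finset.mul_sum]
    _ ≤ _ := mul_le_mul_right (cq_norm _ _ _ _) _

lemma cT_order {n : ℕ} (j : (Fin n →₀ ℕ) → (Fin n →₀ ℕ)) (A : Finset (Fin n →₀ ℕ))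
    (t : (Fin n →₀ ℕ) → MvPowerSeries (Fin n) ℂ)
    (ht : ∀ α ∈ A, ∀ β, cNN β ≤ cNN α → MvPowerSeries.coeff β (t α) = 0)
    (f : MvPowerSeries (Fin n) ℂ) (K : ℕ)
    (hf : ∀ β, cNN β < K → MvPowerSeries.coeff β f = 0) :
    ∀ β, cNN β < K + 1 → MvPowerSeries.coeff β (cT j A t f) = 0 := by
  classical
  intro β hβ
  rw [cT, map_neg, map_sum, neg_eq_zero]
  refine Finset.sum_eq_zero fun α hα => ?_
  rw [MvPowerSeries.coeff_mul]
  refine Finset.sum_eq_zero fun p hp => ?_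
  have hp' := Finset.HasAntidiagonal.mem_antidiagonal.1 hp
  by_cases h2 : cNN p.2 ≤ cNN α
  · rw [ht α hα _ h2, mul_zero]
  · rw [coeff_cq, hf, ite_self, zero_mul]
    rw [cNN_add]
    rw [← hp', cNN_add] at hβ
    have : cNN p.1 * cNN α < cNN p.1 * cNN p.2 := Nat.mul_lt_mul_of_pos_left (not_le.1 h2) (cNN_pos _)
    omega

lemma cNeumann {n : ℕ} (T : MvPowerSeries (Fin n) ℂ → MvPowerSeries (Fin n) ℂ)
    (hadd : ∀ f g, T (f + g) = T f + T g) {s : ℕ}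
    (hn : ∀ f, cnrm s (T f) ≤ 2⁻¹ * cnrm s f)
    (hord : ∀ f K, (∀ β, cNN β < K → MvPowerSeries.coeff β f = 0) →
      ∀ β, cNN β < K + 1 → MvPowerSeries.coeff β (T f) = 0)
    (f : MvPowerSeries (Fin n) ℂ) (hf : cnrm s f ≠ ⊤) :
    ∃ F, cnrm s F ≠ ⊤ ∧ F = f + T F := by
  have hk0 : ∀ k β, cNN β < k → MvPowerSeries.coeff β (T^[k] f) = 0 := by
    intro k
    induction k with
    | zero => intro β h; omega
    | succ k ih => rw [Function.iterate_succ_apply']; exact hord _ _ ih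
  have hkn : ∀ k, cnrm s (T^[k] f) ≤ 2⁻¹ ^ k * cnrm s f := by
    intro k
    induction k with
    | zero => simp
    | succ k ih =>
      rw [Function.iterate_succ_apply', pow_succ', mul_assoc]
      exact (hn _).trans (mul_le_mul_right ih _)
  set S : ℕ → MvPowerSeries (Fin n) ℂ := fun K => ∑ k ∈ Finset.range K, T^[k] f with hS
  have hST : ∀ K, S K + T^[K] f = f + T (S K) := by
    have hT0 : T 0 = 0 := by simpa using hadd 0 0
    intro K
    induction K with
    | zero => simp [hS, hT0]
    | succ K ih =>
      have : S (K + 1) = S K + T^[K] f := Finset.sum_range_succ _ _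
      rw [this, hadd, ← add_assoc, ← ih, Function.iterate_succ_apply']
  let F : MvPowerSeries (Fin n) ℂ := fun β => MvPowerSeries.coeff β (S (cNN β + 1))
  have hF : ∀ K β, cNN β < K → MvPowerSeries.coeff β F = MvPowerSeries.coeff β (S K) := by
    intro K β h
    show MvPowerSeries.coeff β (S (cNN β + 1)) = _
    rw [hS]
    simp only [map_sum]
    refine Finset.sum_subset (Finset.range_mono (by omega)) fun k _ hk => hk0 _ _ ?_
    rw [Finset.mem_range] at hk
    omega
  refine ⟨F, ?_, ?_⟩
  · have : cnrm s F ≤ ∑' k, 2⁻¹ ^ k * cnrm s f := by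
      calc cnrm s F ≤ ∑' β, ∑' k, ‖MvPowerSeries.coeff β (T^[k] f)‖ₑ * cw s β := by
            refine ENNReal.tsum_le_tsum fun β => ?_
            rw [ENNReal.tsum_mul_right]
            refine mul_le_mul_left ?_ _
            show ‖MvPowerSeries.coeff β (S (cNN β + 1))‖ₑ ≤ _
            rw [hS]
            simp only [map_sum]
            exact (enorm_sum_le _ _).trans (ENNReal.sum_le_tsum _)
        _ = ∑' k, cnrm s (T^[k] f) := ENNReal.tsum_comm
        _ ≤ _ := ENNReal.tsum_le_tsum hkn
    refine ne_top_of_le_ne_top ?_ this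
    rw [ENNReal.tsum_mul_right, ENNReal.tsum_geometric]
    refine ENNReal.mul_ne_top ?_ hf
    rw [ENNReal.one_sub_inv_two, inv_inv]
    simp
  · ext β
    set K := cNN β + 1
    have hD : T F = T (S K) + T (F - S K) := by rw [← hadd]; congr 1; ring
    have h1 := hord (F - S K) K (fun γ hγ => by rw [map_sub, hF K γ hγ, sub_self]) β (by omega)
    rw [hD, ← add_assoc, ← hST, map_add, map_add, h1, hk0 K β (by omega), hF K β (by omega)]
    simp

theorem cdiv {n : ℕ} (A : Finset (Fin n →₀ ℕ)) (g : (Fin n →₀ ℕ) → MvPowerSeries (Fin n) ℂ)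
    (hg : ∀ α ∈ A, CConv (g α)) (hg1 : ∀ α ∈ A, MvPowerSeries.coeff α (g α) = 1)
    (hg0 : ∀ α ∈ A, ∀ β, cNN β < cNN α → MvPowerSeries.coeff β (g α) = 0)
    (f : MvPowerSeries (Fin n) ℂ) (hf : CConv f) :
    ∃ (a : (Fin n →₀ ℕ) → MvPowerSeries (Fin n) ℂ) (r : MvPowerSeries (Fin n) ℂ),
      (∀ α ∈ A, CConv (a α)) ∧ f = ∑ α ∈ A, a α * g α + r ∧
      ∀ α ∈ A, ∀ β, α ≤ β → MvPowerSeries.coeff β r = 0 := by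
  classical
  have hj : ∀ β : Fin n →₀ ℕ, ∃ α, (∃ α' ∈ A, α' ≤ β) → α ∈ A ∧ α ≤ β := by
    intro β
    by_cases h : ∃ α' ∈ A, α' ≤ β
    · obtain ⟨α, h1, h2⟩ := h; exact ⟨α, fun _ => ⟨h1, h2⟩⟩
    · exact ⟨0, fun h' => absurd h' h⟩
  choose j hj using hj
  set t : (Fin n →₀ ℕ) → MvPowerSeries (Fin n) ℂ := fun α => g α - MvPowerSeries.monomial α 1 with ht
  have ht0 : ∀ α ∈ A, ∀ β, cNN β ≤ cNN α → MvPowerSeries.coeff β (t α) = 0 := by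
    intro α hα β hβ
    rw [ht]
    simp only [map_sub, MvPowerSeries.coeff_monomial]
    split_ifs with h
    · rw [h, hg1 α hα, sub_self]
    · rw [hg0 α hα β (lt_of_le_of_ne hβ fun h' => h (cNN_inj h')), sub_self]
  have hev : ∀ᶠ s in atTop, ∀ α ∈ A, cnrm s (t α) ≤ 2⁻¹ * cw s α := by
    rw [Filter.eventually_all_finset]
    intro α hα
    exact cnrm_tail ((hg α hα).sub (CConv.monomial _ _)) α (ht0 α hα) (by simp)
  obtain ⟨s0, hs0⟩ := hf
  obtain ⟨s, hs1, hs2⟩ := (hev.and (eventually_ge_atTop s0)).exists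
  have hfs : cnrm s f ≠ ⊤ := ne_top_of_le_ne_top hs0 (cnrm_anti hs2 f)
  obtain ⟨F, hF1, hF2⟩ := cNeumann (cT j A t) (cT_add j A t) (cT_norm j A t hs1)
    (fun f K h => cT_order j A t ht0 f K h) f hfs
  let r : MvPowerSeries (Fin n) ℂ := fun β => if ∃ α' ∈ A, α' ≤ β then 0 else MvPowerSeries.coeff β F
  have hr : ∀ β, MvPowerSeries.coeff β r = if ∃ α' ∈ A, α' ≤ β then 0 else MvPowerSeries.coeff β F :=
    fun β => rfl
  have hdec : F = ∑ α ∈ A, cq j α F * MvPowerSeries.monomial α 1 + r := by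
    ext β
    rw [map_add, map_sum, hr]
    have h1 : ∀ α ∈ A, MvPowerSeries.coeff β (cq j α F * MvPowerSeries.monomial α 1) =
        if α = j β ∧ α ≤ β then MvPowerSeries.coeff β F else 0 := by
      intro α hα
      rw [MvPowerSeries.coeff_mul_monomial, coeff_cq, mul_one]
      by_cases h : α ≤ β
      · simp [h, tsub_add_cancel_of_le h, eq_comm]
      · simp [h]
    rw [Finset.sum_congr rfl h1]
    split_ifs with h
    · obtain ⟨h3, h4⟩ := hj β h
      rw [Finset.sum_eq_single (j β)]
      · simp [h4]
      · intro α _ hα; rw [if_neg (fun h => hα h.1)]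
      · intro h; exact absurd h3 h
    · rw [Finset.sum_eq_zero, zero_add]
      intro α hα
      rw [if_neg (fun h' => h ⟨α, hα, h'.2⟩)]
  refine ⟨fun α => cq j α F, r, fun α _ => ⟨s, cq_norm_single j α hF1⟩, ?_, ?_⟩
  · have h1 : f = F - cT j A t F := by rw [eq_sub_iff_add_eq]; exact hF2.symm
    have h2 : ∑ α ∈ A, cq j α F * g α = ∑ α ∈ A, cq j α F * MvPowerSeries.monomial α 1 +
        ∑ α ∈ A, cq j α F * t α := by
      rw [← Finset.sum_add_distrib]
      refine Finset.sum_congr rfl fun α _ => ?_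
      rw [ht]; ring
    rw [h1, h2, cT, sub_neg_eq_add]
    nth_rewrite 1 [hdec]
    ring
  · intro α hα β h
    rw [hr, if_pos ⟨α, hα, h⟩]

theorem cclosed {n : ℕ} (J : Set (MvPowerSeries (Fin n) ℂ))
    (hJ0 : 0 ∈ J)
    (hJadd : ∀ f ∈ J, ∀ g ∈ J, f + g ∈ J) (hJmul : ∀ a, CConv a → ∀ f ∈ J, a * f ∈ J)
    (hJc : ∀ f ∈ J, CConv f) (f : MvPowerSeries (Fin n) ℂ) (hf : CConv f)
    (happ : ∀ K : ℕ, ∃ i ∈ J, ∀ β, cNN β < K → MvPowerSeries.coeff β f = MvPowerSeries.coeff β i) :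
    f ∈ J := by
  classical
  set E : Set (Fin n →₀ ℕ) := {α | ∃ f ∈ J, MvPowerSeries.coeff α f = 1 ∧
    ∀ β, cNN β < cNN α → MvPowerSeries.coeff β f = 0} with hE
  have hfin : {x | Minimal (· ∈ E) x}.Finite :=
    WellQuasiOrderedLE.finite_of_isAntichain (setOfPred_minimal_antichain _)
  have hchoice : ∀ α, ∃ g : MvPowerSeries (Fin n) ℂ, α ∈ E → g ∈ J ∧ MvPowerSeries.coeff α g = 1 ∧
    ∀ β, cNN β < cNN α → MvPowerSeries.coeff β g = 0 := by
    intro α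
    by_cases h : α ∈ E
    · obtain ⟨g, h1, h2⟩ := h; exact ⟨g, fun _ => ⟨h1, h2⟩⟩
    · exact ⟨0, fun h' => absurd h' h⟩
  choose g hg using hchoice
  set A := hfin.toFinset with hA
  have hAE : ∀ α ∈ A, α ∈ E := fun α hα => ((Set.Finite.mem_toFinset hfin).1 hα).prop
  obtain ⟨a, r, ha, hfa, hr⟩ := cdiv A g (fun α hα => hJc _ (hg α (hAE α hα)).1)
    (fun α hα => (hg α (hAE α hα)).2.1) (fun α hα => (hg α (hAE α hα)).2.2) f hf
  have hsum : ∀ (B : Finset (Fin n →₀ ℕ)) (u : (Fin n →₀ ℕ) → MvPowerSeries (Fin n) ℂ),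
      (∀ α ∈ B, u α ∈ J) → ∑ α ∈ B, u α ∈ J := fun B u h =>
    Finset.sum_induction _ (· ∈ J) (fun x y hx hy => hJadd x hx y hy) hJ0 h
  have hq : ∑ α ∈ A, a α * g α ∈ J :=
    hsum _ _ fun α hα => hJmul _ (ha α hα) _ (hg α (hAE α hα)).1
  have hsmul : ∀ (c : ℂ) (f : MvPowerSeries (Fin n) ℂ), f ∈ J → MvPowerSeries.C c * f ∈ J :=
    fun c f h => hJmul _ (by rw [← MvPowerSeries.monomial_zero_eq_C_apply]; exact CConv.monomial _ _) _ h
  suffices hr0 : r = 0 by rw [hfa, hr0, add_zero]; exact hq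
  by_contra hne
  have hex : ∃ β, MvPowerSeries.coeff β r ≠ 0 := by
    by_contra hcon
    push Not at hcon
    exact hne (MvPowerSeries.ext fun β => by rw [hcon β, map_zero])
  obtain ⟨β, hβ, hmin⟩ := WellFounded.has_min (InvImage.wf cNN Nat.lt_wfRel.wf)
    {β | MvPowerSeries.coeff β r ≠ 0} hex
  obtain ⟨i, hi, hif⟩ := happ (cNN β + 1)
  have hiJ : i + MvPowerSeries.C (-1) * ∑ α ∈ A, a α * g α ∈ J := hJadd _ hi _ (hsmul _ _ hq)
  have hir : ∀ γ, cNN γ < cNN β + 1 →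
      MvPowerSeries.coeff γ (i + MvPowerSeries.C (-1) * ∑ α ∈ A, a α * g α) = MvPowerSeries.coeff γ r := by
    intro γ hγ
    rw [map_add, ← hif γ hγ, ← map_add]
    congr 1
    conv_lhs => rw [hfa]
    simp
  have hβE : β ∈ E := by
    refine ⟨MvPowerSeries.C (MvPowerSeries.coeff β r)⁻¹ * _, hsmul _ _ hiJ, ?_, ?_⟩
    · rw [MvPowerSeries.coeff_C_mul, hir β (by omega), inv_mul_cancel₀ hβ]
    · intro γ hγ
      rw [MvPowerSeries.coeff_C_mul, hir γ (by omega)]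
      have : MvPowerSeries.coeff γ r = 0 := by
        by_contra h
        exact hmin γ h hγ
      rw [this, mul_zero]
  obtain ⟨α, hαβ, hα⟩ := exists_minimal_le_of_wellFoundedLT (· ∈ E) β hβE
  exact hβ (hr α ((Set.Finite.mem_toFinset hfin).2 hα) β hαβ)

end CartanAux2
noncomputable section CartanAux3
open scoped ENNReal

/-- monomials -/
def cmon {n : ℕ} (z : Fin n → ℂ) (β : Fin n →₀ ℕ) : ℂ := ∏ i, z i ^ β i

lemma cmon_add {n : ℕ} (z : Fin n → ℂ) (a b : Fin n →₀ ℕ) :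
    cmon z (a + b) = cmon z a * cmon z b := by
  simp [cmon, pow_add, Finset.prod_mul_distrib]

lemma cw_eq_prod {n : ℕ} (s : ℕ) (β : Fin n →₀ ℕ) :
    cw s β = ∏ i, (((cpr i : ℝ≥0∞) ^ s)⁻¹) ^ β i := by
  rw [cw, cNN]
  push_cast
  rw [← Finset.prod_pow, ENNReal.prod_inv_distrib]
  · refine Finset.prod_congr rfl fun i _ => ?_
    rw [← ENNReal.inv_pow, ← pow_mul, ← pow_mul, mul_comm]
  · intro i _ k _ _
    right
    exact ENNReal.pow_ne_top (ENNReal.pow_ne_top (ENNReal.natCast_ne_top _))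

lemma cmon_le {n : ℕ} {s : ℕ} {z : Fin n → ℂ} (hz : ∀ i, ‖z i‖ₑ ≤ ((cpr i : ℝ≥0∞) ^ s)⁻¹)
    (β : Fin n →₀ ℕ) : ‖cmon z β‖ₑ ≤ cw s β := by
  have : ‖cmon z β‖ₑ = ∏ i, ‖z i‖ₑ ^ β i := by
    rw [cmon]
    simp only [enorm_eq_nnnorm, nnnorm_prod, nnnorm_pow]
    push_cast
    rfl
  rw [this, cw_eq_prod]
  exact Finset.prod_le_prod' fun i _ => pow_le_pow_left' (hz i) _

lemma csummable {n : ℕ} {s : ℕ} {c : MvPowerSeries (Fin n) ℂ} (hc : cnrm s c ≠ ⊤)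
    {z : Fin n → ℂ} (hz : ∀ i, ‖z i‖ₑ ≤ ((cpr i : ℝ≥0∞) ^ s)⁻¹) :
    Summable fun β => ‖MvPowerSeries.coeff β c * cmon z β‖ := by
  rw [← tsum_enorm_ne_top_iff_summable_norm]
  refine ne_top_of_le_ne_top hc (ENNReal.tsum_le_tsum fun β => ?_)
  rw [enorm_mul]
  exact mul_le_mul_right (cmon_le hz β) _

lemma cz_ev {n : ℕ} (s : ℕ) :
    ∀ᶠ z in 𝓝 (0 : Fin n → ℂ), ∀ i, ‖z i‖ₑ ≤ ((cpr i : ℝ≥0∞) ^ s)⁻¹ := by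
  rw [Filter.eventually_all]
  intro i
  have h1 : Tendsto (fun z : Fin n → ℂ => ‖z i‖ₑ) (𝓝 0) (𝓝 0) := by
    have : Continuous (fun z : Fin n → ℂ => ‖z i‖ₑ) := by fun_prop
    simpa using this.tendsto 0
  refine (h1.eventually_lt_const ?_).mono fun z hz => hz.le
  simp [ENNReal.pow_eq_top_iff]

lemma csummable_ev {n : ℕ} {c : MvPowerSeries (Fin n) ℂ} (hc : CConv c) :
    ∀ᶠ z in 𝓝 (0 : Fin n → ℂ), Summable fun β => ‖MvPowerSeries.coeff β c * cmon z β‖ := by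
  obtain ⟨s, hs⟩ := hc
  exact (cz_ev s).mono fun z hz => csummable hs hz

/-- `c` represents the germ of `f` -/
def CRep {n : ℕ} (f : (Fin n → ℂ) → ℂ) (c : MvPowerSeries (Fin n) ℂ) : Prop :=
  CConv c ∧ ∀ᶠ z in 𝓝 (0 : Fin n → ℂ), HasSum (fun β => MvPowerSeries.coeff β c * cmon z β) (f z)

lemma CRep.congr {n : ℕ} {f g : (Fin n → ℂ) → ℂ} {c : MvPowerSeries (Fin n) ℂ} (h : CRep f c)
    (hfg : ∀ᶠ z in 𝓝 (0 : Fin n → ℂ), g z = f z) : CRep g c :=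
  ⟨h.1, by filter_upwards [h.2, hfg] with z h1 h2; rwa [h2]⟩

lemma CRep.add {n : ℕ} {f g : (Fin n → ℂ) → ℂ} {c d : MvPowerSeries (Fin n) ℂ} (h : CRep f c)
    (h' : CRep g d) : CRep (fun z => f z + g z) (c + d) := by
  refine ⟨h.1.add h'.1, ?_⟩
  filter_upwards [h.2, h'.2] with z h1 h2
  simpa [add_mul] using h1.add h2

lemma CRep.sub {n : ℕ} {f g : (Fin n → ℂ) → ℂ} {c d : MvPowerSeries (Fin n) ℂ} (h : CRep f c)
    (h' : CRep g d) : CRep (fun z => f z - g z) (c - d) := by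
  refine ⟨h.1.sub h'.1, ?_⟩
  filter_upwards [h.2, h'.2] with z h1 h2
  simpa [sub_mul] using h1.sub h2

lemma cprod_hasSum {n : ℕ} {u v : (Fin n →₀ ℕ) → ℂ} {x y : ℂ} (h1 : HasSum u x) (h2 : HasSum v y)
    (h3 : Summable fun β => ‖u β‖) (h4 : Summable fun β => ‖v β‖) :
    HasSum (fun β => ∑ p ∈ Finset.HasAntidiagonal.antidiagonal β, u p.1 * v p.2) (x * y) := by
  have h5 := summable_mul_of_summable_norm h3 h4
  have h6 := summable_sum_mul_antidiagonal_of_summable_mul h5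
  have h7 := Summable.tsum_mul_tsum_eq_tsum_sum_antidiagonal h1.summable h2.summable h5
  rw [h1.tsum_eq, h2.tsum_eq] at h7
  rw [h7]
  exact h6.hasSum

lemma CRep.mul {n : ℕ} {f g : (Fin n → ℂ) → ℂ} {c d : MvPowerSeries (Fin n) ℂ} (h : CRep f c)
    (h' : CRep g d) : CRep (fun z => f z * g z) (c * d) := by
  refine ⟨h.1.mul h'.1, ?_⟩
  filter_upwards [h.2, h'.2, csummable_ev h.1, csummable_ev h'.1] with z h1 h2 h3 h4
  refine (cprod_hasSum h1 h2 h3 h4).congr_fun ?_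
  intro β
  rw [MvPowerSeries.coeff_mul, Finset.sum_mul]
  refine Finset.sum_congr rfl fun p hp => ?_
  rw [← Finset.HasAntidiagonal.mem_antidiagonal.1 hp, cmon_add]
  ring

lemma CRep.zero {n : ℕ} : CRep (fun _ : Fin n → ℂ => (0 : ℂ)) 0 :=
  ⟨CConv.zero, by simp [hasSum_zero]⟩

lemma CRep.sum {n : ℕ} {ι : Type*} (A : Finset ι) {f : ι → (Fin n → ℂ) → ℂ}
    {c : ι → MvPowerSeries (Fin n) ℂ} (h : ∀ i ∈ A, CRep (f i) (c i)) :
    CRep (fun z => ∑ i ∈ A, f i z) (∑ i ∈ A, c i) := by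
  classical
  induction A using Finset.induction_on with
  | empty => simpa using CRep.zero
  | insert a A ha ih =>
    simp only [Finset.sum_insert ha]
    exact (h a (Finset.mem_insert_self _ _)).add (ih fun i hi => h i (Finset.mem_insert_of_mem hi))

lemma CRep.eq_zero {n : ℕ} {c : MvPowerSeries (Fin n) ℂ} (h : CRep (fun _ => 0) c) : c = 0 := by
  classical
  by_contra hne
  have hex : ∃ β, MvPowerSeries.coeff β c ≠ 0 := by
    by_contra hcon
    push Not at hcon
    exact hne (MvPowerSeries.ext fun β => by rw [hcon β, map_zero])
  obtain ⟨α, hα, hmin⟩ := WellFounded.has_min (InvImage.wf cNN Nat.lt_wfRel.wf)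
    {β | MvPowerSeries.coeff β c ≠ 0} hex
  set b := MvPowerSeries.coeff α c with hb
  set t := c - MvPowerSeries.monomial α b with ht
  have htc : CConv t := h.1.sub (CConv.monomial _ _)
  have ht0 : ∀ β, cNN β ≤ cNN α → MvPowerSeries.coeff β t = 0 := by
    intro β hβ
    rw [ht, map_sub, MvPowerSeries.coeff_monomial]
    split_ifs with h'
    · rw [h', ← hb, sub_self]
    · rw [sub_zero]
      by_contra h2
      exact hmin β h2 (lt_of_le_of_ne hβ fun h3 => h' (cNN_inj h3))
  have hbpos : 0 < ‖b‖ₑ / 2 := by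
    refine ENNReal.div_pos ?_ (by simp)
    simpa using hα
  have htail := cnrm_tail htc α ht0 hbpos
  let z : ℕ → Fin n → ℂ := fun s i => (((cpr i : ℂ)) ^ s)⁻¹
  have hz0 : Tendsto z atTop (𝓝 0) := by
    rw [tendsto_pi_nhds]
    intro i
    have : ‖((cpr i : ℂ))⁻¹‖ < 1 := by
      rw [norm_inv, Complex.norm_natCast]
      exact inv_lt_one_of_one_lt₀ (by exact_mod_cast (cpr_prime i).one_lt)
    have h2 := tendsto_pow_atTop_nhds_zero_of_norm_lt_one this
    simpa [z, inv_pow] using h2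
  have hnz : ∀ s i, ‖z s i‖ₑ = ((cpr i : ℝ≥0∞) ^ s)⁻¹ := by
    intro s i
    have h0 : (cpr i : ℂ) ≠ 0 := by exact_mod_cast (cpr_prime i).ne_zero
    simp only [z]
    rw [enorm_inv (pow_ne_zero _ h0), enorm_pow]
    congr 2
    simp [enorm_eq_nnnorm]
  have hnm : ∀ s, ‖cmon (z s) α‖ₑ = cw s α := by
    intro s
    have : ‖cmon (z s) α‖ₑ = ∏ i, ‖z s i‖ₑ ^ α i := by
      rw [cmon]
      simp only [enorm_eq_nnnorm, nnnorm_prod, nnnorm_pow]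
      push_cast
      rfl
    rw [this, cw_eq_prod]
    simp only [hnz]
  obtain ⟨s0, hs0⟩ := id htc
  obtain ⟨s, h1, h2, h3⟩ := (htail.and ((hz0.eventually h.2).and (eventually_ge_atTop s0))).exists
  have hts : cnrm s t ≠ ⊤ := ne_top_of_le_ne_top hs0 (cnrm_anti h3 t)
  have hm : HasSum (fun β => MvPowerSeries.coeff β (MvPowerSeries.monomial α b) * cmon (z s) β)
      (b * cmon (z s) α) := by
    convert hasSum_single α ?_ using 1
    · simp
    · intro β hβ
      simp [MvPowerSeries.coeff_monomial, hβ]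
  have hsub := h2.sub hm
  simp only [← sub_mul, ← map_sub, ← ht] at hsub
  have h4 : ‖b * cmon (z s) α‖ₑ ≤ cnrm s t := by
    have h5 : ‖b * cmon (z s) α‖ₑ = ‖∑' β, MvPowerSeries.coeff β t * cmon (z s) β‖ₑ := by
      rw [hsub.tsum_eq, zero_sub, enorm_neg]
    rw [h5]
    refine enorm_tsum_le_tsum_enorm.trans (ENNReal.tsum_le_tsum fun β => ?_)
    rw [enorm_mul]
    exact mul_le_mul_right (cmon_le (fun i => (hnz s i).le) β) _
  rw [enorm_mul, hnm] at h4
  have h6 := h4.trans h1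
  rw [ENNReal.mul_le_mul_iff_left (cw_ne_zero _ _) (cw_ne_top _ _)] at h6
  exact absurd h6 (not_le.2 (ENNReal.half_lt_self (by simpa using hα) enorm_ne_top))

lemma CRep.unique {n : ℕ} {f : (Fin n → ℂ) → ℂ} {c d : MvPowerSeries (Fin n) ℂ} (h : CRep f c)
    (h' : CRep f d) : c = d := by
  have := h.sub h'
  simp only [sub_self] at this
  exact sub_eq_zero.1 this.eq_zero

lemma cenum {n : ℕ} (d : ℕ) : ∀ β : Fin n →₀ ℕ, ∑ i, β i = d →
    ∃ e : Fin d → Fin n, ∀ z : Fin n → ℂ, ∏ k, z (e k) = cmon z β := by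
  classical
  induction d with
  | zero =>
    intro β h
    refine ⟨Fin.elim0, fun z => ?_⟩
    have : β = 0 := by
      ext i
      exact (Finset.sum_eq_zero_iff.1 h) i (Finset.mem_univ _)
    simp [this, cmon]
  | succ d ih =>
    intro β h
    obtain ⟨i, hi⟩ : ∃ i, β i ≠ 0 := by
      by_contra hcon
      push Not at hcon
      simp [hcon] at h
    have hβ : β = Finsupp.single i 1 + (β - Finsupp.single i 1) := by
      rw [add_tsub_cancel_of_le]
      rw [Finsupp.single_le_iff]
      omega
    set γ := β - Finsupp.single i 1
    have hγ : ∑ i, γ i = d := by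
      have h1 : ∑ k, β k = 1 + ∑ k, γ k := by
        conv_lhs => rw [hβ]
        simp [Finset.sum_add_distrib, Finsupp.single_apply]
      omega
    obtain ⟨e, he⟩ := ih γ hγ
    refine ⟨Fin.cons i e, fun z => ?_⟩
    rw [Fin.prod_univ_succ, hβ, cmon_add]
    simp only [Fin.cons_zero, Fin.cons_succ, he]
    congr 1
    rw [cmon, Finset.prod_eq_single i]
    · simp
    · intro k _ hk
      simp [Ne.symm hk]
    · simp

lemma cmulti {n : ℕ} (d : ℕ) (β : Fin n →₀ ℕ) (h : ∑ i, β i = d) :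
    ∃ m : ContinuousMultilinearMap ℂ (fun _ : Fin d => Fin n → ℂ) ℂ,
      (∀ z, m (fun _ => z) = cmon z β) ∧ ‖m‖ ≤ 1 := by
  obtain ⟨e, he⟩ := cenum d β h
  refine ⟨(ContinuousMultilinearMap.mkPiAlgebra ℂ (Fin d) ℂ).compContinuousLinearMap
    (fun k => ContinuousLinearMap.proj (e k)), fun z => ?_, ?_⟩
  · simp [he]
  · refine ContinuousMultilinearMap.opNorm_le_bound zero_le_one fun v => ?_
    simp only [ContinuousMultilinearMap.compContinuousLinearMap_apply,
      ContinuousMultilinearMap.mkPiAlgebra_apply, ContinuousLinearMap.proj_apply, norm_prod, one_mul]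
    exact Finset.prod_le_prod (fun _ _ => norm_nonneg _) fun k _ => norm_le_pi_norm _ _

lemma cmon_norm_le {n : ℕ} {z : Fin n → ℂ} {ρ : ℝ} (hz : ‖z‖ ≤ ρ) (β : Fin n →₀ ℕ) :
    ‖cmon z β‖ ≤ ρ ^ (∑ i, β i) := by
  rw [cmon, norm_prod, ← Finset.prod_pow_eq_pow_sum]
  refine Finset.prod_le_prod (fun _ _ => norm_nonneg _) fun k _ => ?_
  rw [norm_pow]
  exact pow_le_pow_left₀ (norm_nonneg _) ((norm_le_pi_norm z k).trans hz) _

lemma cdeg_finite {n : ℕ} (d : ℕ) : Finite {β : Fin n →₀ ℕ // ∑ i, β i = d} := by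
  classical
  refine Set.Finite.to_subtype (s := {β : Fin n →₀ ℕ | ∑ i, β i = d}) ?_
  refine (Finset.finite_toSet (Finset.finsuppAntidiag Finset.univ d)).subset fun β hβ => ?_
  rw [Finset.mem_coe, Finset.mem_finsuppAntidiag]
  exact ⟨hβ, Finset.subset_univ _⟩

lemma canalytic {n : ℕ} {c : MvPowerSeries (Fin n) ℂ} (hc : CConv c) :
    ∃ f, AnalyticAt ℂ f 0 ∧ CRep f c := by
  obtain ⟨ε, hε, hb⟩ := Metric.eventually_nhds_iff_ball.1 (csummable_ev hc)
  set ρ : NNReal := ⟨ε / 2, by positivity⟩ with hρ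
  have hρ0 : 0 < (ρ : ℝ) := by show 0 < ε / 2; positivity
  have hs : Summable fun β : Fin n →₀ ℕ => ‖MvPowerSeries.coeff β c‖ * (ρ : ℝ) ^ (∑ i, β i) := by
    have h1 := hb (fun _ => ((ρ : ℝ) : ℂ)) (by
      rw [mem_ball_zero_iff, pi_norm_lt_iff hε]
      intro i
      rw [Complex.norm_real, Real.norm_of_nonneg hρ0.le]
      show ε / 2 < ε
      linarith)
    refine h1.congr fun β => ?_
    rw [norm_mul, cmon, norm_prod, ← Finset.prod_pow_eq_pow_sum]
    simp
  have hsy : ∀ y : Fin n → ℂ, ‖y‖ ≤ ρ → Summable fun β => MvPowerSeries.coeff β c * cmon y β := by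
    intro y hy
    refine Summable.of_norm_bounded hs fun β => ?_
    rw [norm_mul]
    exact mul_le_mul_of_nonneg_left (cmon_norm_le hy β) (norm_nonneg _)
  let f : (Fin n → ℂ) → ℂ := fun z => ∑' β, MvPowerSeries.coeff β c * cmon z β
  choose m hm1 hm2 using (cmulti (n := n))
  have : ∀ d, Fintype {β : Fin n →₀ ℕ // ∑ i, β i = d} := fun d =>
    haveI := cdeg_finite (n := n) d
    Fintype.ofFinite _
  let p : FormalMultilinearSeries ℂ (Fin n → ℂ) ℂ := fun d =>
    ∑ β : {β : Fin n →₀ ℕ // ∑ i, β i = d}, MvPowerSeries.coeff β.1 c • m d β.1 β.2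
  have hp : HasFPowerSeriesOnBall f p 0 (ρ : ℝ≥0∞) := by
    refine ⟨?_, by exact_mod_cast hρ0, ?_⟩
    · refine p.le_radius_of_bound (∑' β : Fin n →₀ ℕ, ‖MvPowerSeries.coeff β c‖ * (ρ : ℝ) ^ (∑ i, β i)) ?_
      intro d
      calc ‖p d‖ * (ρ : ℝ) ^ d ≤ (∑ β : {β : Fin n →₀ ℕ // ∑ i, β i = d}, ‖MvPowerSeries.coeff β.1 c‖) * (ρ : ℝ) ^ d := by
            refine mul_le_mul_of_nonneg_right ?_ (by positivity)
            refine (norm_sum_le _ _).trans (Finset.sum_le_sum fun β _ => ?_)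
            rw [norm_smul]
            exact mul_le_of_le_one_right (norm_nonneg _) (hm2 _ _ _)
        _ = ∑ β : {β : Fin n →₀ ℕ // ∑ i, β i = d}, ‖MvPowerSeries.coeff β.1 c‖ * (ρ : ℝ) ^ (∑ i, β.1 i) := by
            rw [Finset.sum_mul]
            refine Finset.sum_congr rfl fun β _ => ?_
            rw [β.2]
        _ ≤ _ := by
            rw [← tsum_fintype (L := .unconditional _)]
            exact hs.tsum_subtype_le _ {β : Fin n →₀ ℕ | ∑ i, β i = d} (fun β => by positivity)
    · intro y hy
      have hy' : ‖y‖ ≤ ρ := by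
        rw [Metric.eball_coe, mem_ball_zero_iff] at hy
        exact hy.le
      rw [zero_add]
      have h1 := (hsy y hy').hasSum
      have h2 := (Equiv.sigmaFiberEquiv (fun β : Fin n →₀ ℕ => ∑ i, β i)).hasSum_iff.2 h1
      refine h2.sigma fun d => ?_
      convert hasSum_fintype _ using 1
      simp only [p, sum_apply, smul_apply, hm1]
      rfl
  refine ⟨f, hp.analyticAt, hc, ?_⟩
  filter_upwards [Metric.closedBall_mem_nhds (0 : Fin n → ℂ) hρ0] with z hz
  exact (hsy z (by simpa using hz)).hasSum

end CartanAux3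
noncomputable section CartanAux4
open scoped ENNReal
open MeasureTheory

lemma chasSum_mul {ι κ : Type*} {u : ι → ℂ} {v : κ → ℂ} {x y : ℂ} (h1 : HasSum u x)
    (h2 : HasSum v y) : HasSum (fun p : ι × κ => u p.1 * v p.2) (x * y) :=
  h1.mul h2 (summable_mul_of_summable_norm h1.summable.norm h2.summable.norm)

lemma cgeom' (n : ℕ) : ∀ x : Fin n → ℂ, (∀ i, ‖x i‖ < 1) →
    HasSum (fun β : Fin n → ℕ => ∏ i, x i ^ β i) (∏ i, (1 - x i)⁻¹) := by
  induction n with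
  | zero =>
    intro x _
    have := hasSum_unique (fun β : Fin 0 → ℕ => (1 : ℂ))
    simpa using this
  | succ n ih =>
    intro x hx
    have h1 := hasSum_geometric_of_norm_lt_one (hx 0)
    have h2 := ih (fun i => x i.succ) (fun i => hx _)
    have h3 := chasSum_mul h1 h2
    rw [Fin.prod_univ_succ, ← (Fin.consEquiv (fun _ => ℕ)).hasSum_iff]
    refine h3.congr_fun fun p => ?_
    rw [Function.comp_apply, Fin.prod_univ_succ]
    rfl

lemma cgeom {n : ℕ} {x : Fin n → ℂ} (hx : ∀ i, ‖x i‖ < 1) :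
    HasSum (fun β : Fin n →₀ ℕ => cmon x β) (∏ i, (1 - x i)⁻¹) := by
  have := (Finsupp.equivFunOnFinite (α := Fin n) (M := ℕ)).hasSum_iff.2 (cgeom' n x hx)
  exact this

lemma ctorus_norm {n : ℕ} {r : ℝ} (hr : 0 < r) (θ : Fin n → ℝ) (i : Fin n) :
    ‖torusMap 0 (fun _ => r) θ i‖ = r := by
  simp [torusMap, abs_of_pos hr]

lemma ctorus_cont {n : ℕ} {r : ℝ} (hr : 0 < r) {g : (Fin n → ℂ) → ℂ}
    (hg : ∀ ζ : Fin n → ℂ, (∀ i, ‖ζ i‖ = r) → ContinuousAt g ζ) :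
    Continuous fun θ => g (torusMap 0 (fun _ => r) θ) := by
  have h1 : Continuous (torusMap (0 : Fin n → ℂ) (fun _ => r)) := by
    unfold torusMap; fun_prop
  rw [continuous_iff_continuousAt]
  intro θ
  exact ContinuousAt.comp (f := torusMap (0 : Fin n → ℂ) (fun _ => r)) (hg _ (ctorus_norm hr θ)) h1.continuousAt

lemma ctorus_int {n : ℕ} {r : ℝ} (hr : 0 < r) {g : (Fin n → ℂ) → ℂ}
    (hg : ∀ ζ : Fin n → ℂ, (∀ i, ‖ζ i‖ = r) → ContinuousAt g ζ) :
    TorusIntegrable g 0 (fun _ => r) :=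
  (ctorus_cont hr hg).integrableOn_Icc

lemma ctorus_hasSum {n : ℕ} {r : ℝ} (hr : 0 < r) {F : (Fin n →₀ ℕ) → (Fin n → ℂ) → ℂ}
    {G : (Fin n → ℂ) → ℂ}
    (hF : ∀ β, ∀ ζ : Fin n → ℂ, (∀ i, ‖ζ i‖ = r) → ContinuousAt (F β) ζ)
    (b : (Fin n →₀ ℕ) → ℝ) (hb : Summable b)
    (hFb : ∀ β, ∀ ζ : Fin n → ℂ, (∀ i, ‖ζ i‖ = r) → ‖F β ζ‖ ≤ b β)
    (hs : ∀ ζ : Fin n → ℂ, (∀ i, ‖ζ i‖ = r) → HasSum (fun β => F β ζ) (G ζ)) :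
    HasSum (fun β => ∯ x in T(0, fun _ => r), F β x) (∯ x in T(0, fun _ => r), G x) := by
  unfold torusIntegral
  have hK : ∀ θ : Fin n → ℝ, ‖∏ i : Fin n, (r : ℂ) * Complex.exp (θ i * Complex.I) * Complex.I‖ = r ^ n := by
    intro θ
    simp [norm_prod, abs_of_pos hr]
  refine hasSum_integral_of_dominated_convergence (fun β _ => r ^ n * b β) ?_ ?_ ?_ ?_ ?_
  · intro β
    refine Continuous.aestronglyMeasurable ?_
    refine Continuous.smul (by fun_prop : Continuous fun θ : Fin n → ℝ => ∏ i, (r:ℂ) * Complex.exp (θ i * Complex.I) * Complex.I) (ctorus_cont hr (hF β))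
  · intro β
    refine Eventually.of_forall fun θ => ?_
    rw [norm_smul, hK]
    exact mul_le_mul_of_nonneg_left (hFb β _ (ctorus_norm hr θ)) (by positivity)
  · exact Eventually.of_forall fun θ => hb.mul_left _
  · exact continuous_const.integrableOn_Icc
  · refine Eventually.of_forall fun θ => ?_
    exact (hs _ (ctorus_norm hr θ)).const_smul _

lemma ccauchy (n : ℕ) : ∀ {r : ℝ}, 0 < r → ∀ {f : (Fin n → ℂ) → ℂ},
    (∀ z : Fin n → ℂ, (∀ i, ‖z i‖ ≤ r) → DifferentiableAt ℂ f z) →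
    ∀ z : Fin n → ℂ, (∀ i, ‖z i‖ < r) →
    (∯ ζ in T(0, fun _ => r), (∏ i, (ζ i - z i)⁻¹) * f ζ) = (2 * Real.pi * Complex.I) ^ n * f z := by
  induction n with
  | zero =>
    intro r hr f hf z hz
    rw [torusIntegral_dim0]
    simp [Subsingleton.elim (0 : Fin 0 → ℂ) z]
  | succ n ih =>
    intro r hr f hf z hz
    rw [torusIntegral_succ]
    · have h1 : ∀ x : ℂ, ‖x‖ = r →
          (∯ y in T((0 : Fin (n+1) → ℂ) ∘ Fin.succ, (fun _ => r) ∘ Fin.succ),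
            (∏ i, ((Fin.cons x y : Fin (n+1) → ℂ) i - z i)⁻¹) * f (Fin.cons x y)) =
          (x - z 0)⁻¹ • ((2 * Real.pi * Complex.I) ^ n * f (Fin.cons x (Fin.tail z))) := by
        intro x hx
        have h2 := ih hr (f := fun y => f (Fin.cons x y)) (fun y hy => by
          refine DifferentiableAt.comp (f := fun y : Fin n → ℂ => (Fin.cons x y : Fin (n+1) → ℂ)) y (hf _ ?_) ?_
          · intro i
            refine Fin.cases ?_ (fun i => ?_) i
            · simpa using hx.le
            · simpa using hy i
          · rw [differentiableAt_pi]
            intro i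
            refine Fin.cases ?_ (fun i => ?_) i
            · simp
            · simp only [Fin.cons_succ]; fun_prop) (Fin.tail z) (fun i => hz _)
        rw [← h2, smul_eq_mul, ← torusIntegral_const_mul]
        simp only [Fin.prod_univ_succ, Fin.cons_zero, Fin.cons_succ, mul_assoc]
        rfl
      have h3 : (∮ x in C((0 : Fin (n+1) → ℂ) 0, r), 
          (∯ y in T((0 : Fin (n+1) → ℂ) ∘ Fin.succ, (fun _ => r) ∘ Fin.succ),
            (∏ i, ((Fin.cons x y : Fin (n+1) → ℂ) i - z i)⁻¹) * f (Fin.cons x y))) =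
          ∮ x in C(0, r), (x - z 0)⁻¹ • ((2 * Real.pi * Complex.I) ^ n * f (Fin.cons x (Fin.tail z))) := by
        refine circleIntegral.integral_congr hr.le fun x hx => h1 x ?_
        simpa using hx
      rw [h3, DiffContOnCl.circleIntegral_sub_inv_smul]
      · rw [Fin.cons_self_tail, smul_eq_mul, pow_succ]; ring
      · refine DifferentiableOn.diffContOnCl fun x hx => DifferentiableAt.differentiableWithinAt ?_
        rw [closure_ball _ hr.ne', mem_closedBall_zero_iff] at hx
        refine DifferentiableAt.const_mul ?_ _
        refine DifferentiableAt.comp (f := fun x : ℂ => (Fin.cons x (Fin.tail z) : Fin (n+1) → ℂ)) x (hf _ ?_) ?_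
        · intro i
          refine Fin.cases ?_ (fun i => ?_) i
          · simpa using hx
          · simpa [Fin.tail] using (hz i.succ).le
        · rw [differentiableAt_pi]
          intro i
          refine Fin.cases ?_ (fun i => ?_) i
          · simp
          · simp
      · simpa using hz 0
    · refine ctorus_int hr fun ζ hζ => ?_
      refine ContinuousAt.mul ?_ (hf ζ fun i => (hζ i).le).continuousAt
      refine tendsto_finsetProd _ fun i _ => ?_
      refine ContinuousAt.inv₀ ((continuous_apply i).sub continuous_const).continuousAt ?_
      intro h
      have h1 := hz i
      rw [← sub_eq_zero.1 h, hζ i] at h1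
      exact lt_irrefl _ h1

lemma cosgood {n : ℕ} {r : ℝ} (hr : 0 < r) {f : (Fin n → ℂ) → ℂ}
    (hf : ∀ z : Fin n → ℂ, (∀ i, ‖z i‖ ≤ r) → DifferentiableAt ℂ f z) {M : ℝ}
    (hM : ∀ z : Fin n → ℂ, (∀ i, ‖z i‖ ≤ r) → ‖f z‖ ≤ M) :
    ∃ c : (Fin n →₀ ℕ) → ℂ, (∀ β, ‖c β‖ * r ^ (∑ i, β i) ≤ M) ∧
      ∀ z : Fin n → ℂ, (∀ i, ‖z i‖ < r) → HasSum (fun β => c β * cmon z β) (f z) := by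
  set P : ℂ := 2 * Real.pi * Complex.I with hP
  have hP0 : P ≠ 0 := by simp [hP, Real.pi_ne_zero]
  have hPn : ‖P‖ = 2 * Real.pi := by simp [hP, abs_of_pos Real.pi_pos]
  have hM0 : 0 ≤ M := (norm_nonneg _).trans (hM 0 (by simp [hr.le]))
  have hne : ∀ ζ : Fin n → ℂ, (∀ i, ‖ζ i‖ = r) → ∀ i, ζ i ≠ 0 := by
    intro ζ hζ i h
    have := hζ i
    rw [h, norm_zero] at this
    exact hr.ne this
  refine ⟨fun β => (P ^ n)⁻¹ * ∯ ζ in T(0, fun _ => r), (∏ i, (ζ i ^ (β i + 1))⁻¹) * f ζ, ?_, ?_⟩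
  · intro β
    have h1 : ‖∯ ζ in T(0, fun _ => r), (∏ i, (ζ i ^ (β i + 1))⁻¹) * f ζ‖ ≤
        ((2 * Real.pi) ^ n * ∏ i : Fin n, |r|) * ((r ^ (∑ i, β i) * r ^ n)⁻¹ * M) := by
      refine norm_torusIntegral_le_of_norm_le_const fun θ => ?_
      rw [norm_mul, norm_prod]
      simp only [norm_inv, norm_pow, ctorus_norm hr]
      rw [Finset.prod_inv_distrib, Finset.prod_pow_eq_pow_sum, Finset.sum_add_distrib]
      simp only [Finset.sum_const, Finset.card_univ, Fintype.card_fin, smul_eq_mul, mul_one, pow_add]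
      exact mul_le_mul_of_nonneg_left (hM _ fun i => (ctorus_norm hr θ i).le) (by positivity)
    rw [norm_mul, norm_inv, norm_pow, hPn]
    calc _ ≤ ((2 * Real.pi) ^ n)⁻¹ * (((2 * Real.pi) ^ n * ∏ i : Fin n, |r|) * ((r ^ (∑ i, β i) * r ^ n)⁻¹ * M)) * r ^ (∑ i, β i) := by
          gcongr
      _ = M := by
          have : (2 * Real.pi) ^ n ≠ 0 := by positivity
          simp only [Finset.prod_const, Finset.card_univ, Fintype.card_fin, abs_of_pos hr]
          field_simp
  · intro z hz
    have hx : ∀ ζ : Fin n → ℂ, (∀ i, ‖ζ i‖ = r) → ∀ i, ‖z i / ζ i‖ < 1 := by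
      intro ζ hζ i
      rw [norm_div, hζ, div_lt_one hr]
      exact hz i
    have hsum := ctorus_hasSum hr
      (F := fun β ζ => (∏ i, (ζ i ^ (β i + 1))⁻¹) * f ζ * cmon z β)
      (G := fun ζ => (∏ i, (ζ i - z i)⁻¹) * f ζ) ?_
      (fun β => (r ^ n)⁻¹ * M * ‖cmon (fun i => z i / (r : ℂ)) β‖) ?_ ?_ ?_
    · rw [ccauchy n hr hf z hz] at hsum
      have := hsum.mul_left (P ^ n)⁻¹
      rw [← mul_assoc, inv_mul_cancel₀ (pow_ne_zero _ hP0), one_mul] at this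
      refine this.congr_fun fun β => ?_
      rw [mul_assoc]
      congr 1
      have h2 := torusIntegral_const_mul (cmon z β) (fun ζ : Fin n → ℂ => (∏ i, (ζ i ^ (β i + 1))⁻¹) * f ζ) 0 (fun _ => r)
      rw [mul_comm, ← h2]
      congr 1
      funext ζ
      ring
    · intro β ζ hζ
      refine ContinuousAt.mul (ContinuousAt.mul ?_ (hf ζ fun i => (hζ i).le).continuousAt) continuousAt_const
      refine tendsto_finsetProd _ fun i _ => ?_
      refine ContinuousAt.inv₀ ((continuous_apply i).pow _).continuousAt (pow_ne_zero _ (hne ζ hζ i))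
    · refine (Summable.norm (cgeom (x := fun i => z i / (r : ℂ)) fun i => ?_).summable).mul_left _
      rw [norm_div, Complex.norm_real, Real.norm_of_nonneg hr.le, div_lt_one hr]
      exact hz i
    · intro β ζ hζ
      rw [norm_mul, norm_mul, norm_prod]
      simp only [norm_inv, norm_pow, hζ, cmon, norm_prod, norm_div, Complex.norm_real, Real.norm_of_nonneg hr.le]
      rw [Finset.prod_inv_distrib, Finset.prod_pow_eq_pow_sum, Finset.sum_add_distrib]
      simp only [Finset.sum_const, Finset.card_univ, Fintype.card_fin, smul_eq_mul, mul_one, pow_add, div_pow,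
        Finset.prod_div_distrib, Finset.prod_pow_eq_pow_sum]
      have := hM ζ fun i => (hζ i).le
      calc _ ≤ (r ^ (∑ i, β i) * r ^ n)⁻¹ * M * ∏ i, ‖z i‖ ^ β i := by
            gcongr
        _ = _ := by field_simp
    · intro ζ hζ
      have h1 := (cgeom (hx ζ hζ)).mul_left ((∏ i, (ζ i)⁻¹) * f ζ)
      have heq : (∏ i, (ζ i - z i)⁻¹) * f ζ = (∏ i, (ζ i)⁻¹) * f ζ * ∏ i, (1 - z i / ζ i)⁻¹ := by
        rw [mul_right_comm, ← Finset.prod_mul_distrib]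
        congr 1
        refine Finset.prod_congr rfl fun i _ => ?_
        have h0 := hne ζ hζ i
        rw [← mul_inv]
        congr 1
        field_simp
      show HasSum _ ((∏ i, (ζ i - z i)⁻¹) * f ζ)
      rw [heq]
      refine h1.congr_fun fun β => ?_
      simp only [cmon, div_pow, Finset.prod_div_distrib, pow_succ, mul_inv, Finset.prod_mul_distrib, Finset.prod_inv_distrib]
      rw [div_eq_mul_inv]
      ring

end CartanAux4
noncomputable section CartanAux5
open scoped ENNReal

lemma cNN_ge {n : ℕ} (β : Fin n →₀ ℕ) : 2 ^ (∑ i, β i) ≤ cNN β := by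
  rw [cNN, ← Finset.prod_pow_eq_pow_sum]
  exact Finset.prod_le_prod' fun i _ => Nat.pow_le_pow_left (cpr_prime i).two_le _

lemma CConv_of_bound {n : ℕ} {c : MvPowerSeries (Fin n) ℂ} {r M : ℝ} (hr : 0 < r)
    (h : ∀ β, ‖MvPowerSeries.coeff β c‖ * r ^ (∑ i, β i) ≤ M) : CConv c := by
  obtain ⟨t, ht⟩ := exists_pow_lt_of_lt_one hr (by norm_num : (1 / 2 : ℝ) < 1)
  have hN : ∀ β : Fin n →₀ ℕ, (0 : ℝ) < cNN β := fun β => by exact_mod_cast cNN_pos β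
  have hs : Summable fun β : Fin n →₀ ℕ => M * ((cNN β : ℝ) ^ 2)⁻¹ := by
    refine Summable.mul_left _ ?_
    have h1 : Summable fun k : ℕ => ((k : ℝ) ^ 2)⁻¹ := Real.summable_nat_pow_inv.2 (by norm_num)
    exact h1.comp_injective cNN_inj
  have hs2 : Summable fun β : Fin n →₀ ℕ =>
      ‖MvPowerSeries.coeff β c * (((cNN β : ℂ) ^ (t + 2))⁻¹)‖ := by
    refine Summable.of_nonneg_of_le (fun _ => norm_nonneg _) (fun β => ?_) hs
    rw [norm_mul, norm_inv, norm_pow, Complex.norm_natCast, pow_add, mul_inv, ← mul_assoc]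
    refine mul_le_mul_of_nonneg_right ?_ (by positivity)
    refine le_trans (mul_le_mul_of_nonneg_left ?_ (norm_nonneg _)) (h β)
    calc ((cNN β : ℝ) ^ t)⁻¹ ≤ (((2 : ℝ) ^ (∑ i, β i)) ^ t)⁻¹ := by
          have : ((2 : ℝ) ^ (∑ i, β i)) ≤ cNN β := by exact_mod_cast cNN_ge β
          gcongr
      _ = ((1 / 2 : ℝ) ^ t) ^ (∑ i, β i) := by
          rw [← pow_mul, ← pow_mul, one_div, inv_pow, mul_comm]
      _ ≤ _ := pow_le_pow_left₀ (by positivity) ht.le _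
  refine ⟨t + 2, ?_⟩
  rw [← tsum_enorm_ne_top_iff_summable_norm] at hs2
  convert hs2 using 1
  rw [cnrm]
  refine tsum_congr fun β => ?_
  rw [enorm_mul, cw]
  congr 1
  have h0 : ((cNN β : ℂ) ^ (t + 2)) ≠ 0 := by
    have := cNN_pos β
    exact pow_ne_zero _ (by exact_mod_cast this.ne')
  rw [enorm_inv h0, enorm_pow]
  congr 2
  simp [enorm_eq_nnnorm]

lemma crep_of_diff {n : ℕ} {r : ℝ} (hr : 0 < r) {f : (Fin n → ℂ) → ℂ}
    (hf : ∀ z : Fin n → ℂ, (∀ i, ‖z i‖ ≤ r) → DifferentiableAt ℂ f z) {M : ℝ}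
    (hM : ∀ z : Fin n → ℂ, (∀ i, ‖z i‖ ≤ r) → ‖f z‖ ≤ M) :
    ∃ c : MvPowerSeries (Fin n) ℂ, CRep f c ∧
      ∀ β, ‖MvPowerSeries.coeff β c‖ * r ^ (∑ i, β i) ≤ M := by
  obtain ⟨c, hc, hs⟩ := cosgood hr hf hM
  have hb : ∀ β, ‖MvPowerSeries.coeff β (c : MvPowerSeries (Fin n) ℂ)‖ * r ^ (∑ i, β i) ≤ M := hc
  refine ⟨c, ⟨CConv_of_bound hr hb, ?_⟩, hb⟩
  have h1 : ∀ᶠ z in 𝓝 (0 : Fin n → ℂ), ‖z‖ < r := by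
    have : Tendsto (fun z : Fin n → ℂ => ‖z‖) (𝓝 0) (𝓝 0) := by
      simpa using (continuous_norm (E := Fin n → ℂ)).tendsto 0
    exact this.eventually_lt_const hr
  filter_upwards [h1] with z hz
  exact hs z fun i => (norm_le_pi_norm z i).trans_lt hz

lemma cpoly_eq {n : ℕ} {r : ℝ} (hr : 0 < r) :
    {z : Fin n → ℂ | ∀ i, ‖z i‖ ≤ r} = closedBall 0 r := by
  ext z
  simp [pi_norm_le_iff_of_nonneg hr.le]

lemma crep_of_diff' {n : ℕ} {r : ℝ} (hr : 0 < r) {f : (Fin n → ℂ) → ℂ}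
    (hf : ∀ z : Fin n → ℂ, (∀ i, ‖z i‖ ≤ r) → DifferentiableAt ℂ f z) :
    ∃ c : MvPowerSeries (Fin n) ℂ, CRep f c := by
  have hK : IsCompact {z : Fin n → ℂ | ∀ i, ‖z i‖ ≤ r} := by
    rw [cpoly_eq hr]; exact isCompact_closedBall _ _
  obtain ⟨M, hM⟩ := hK.exists_bound_of_continuousOn (f := f)
    (fun z hz => (hf z hz).continuousAt.continuousWithinAt)
  obtain ⟨c, h, _⟩ := crep_of_diff hr hf hM
  exact ⟨c, h⟩

lemma crep_of_analytic {n : ℕ} {f : (Fin n → ℂ) → ℂ} (hf : AnalyticAt ℂ f 0) :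
    ∃ c : MvPowerSeries (Fin n) ℂ, CRep f c := by
  obtain ⟨r, hr, h⟩ := Metric.nhds_basis_closedBall.eventually_iff.1 hf.eventually_analyticAt
  refine crep_of_diff' hr fun z hz => (h ?_).differentiableAt
  rw [← cpoly_eq hr]
  exact hz

/-- the ideal of convergent power series generated by `G` -/
def cJ {n m : ℕ} (G : Fin m → MvPowerSeries (Fin n) ℂ) : Set (MvPowerSeries (Fin n) ℂ) :=
  {f | ∃ b : Fin m → MvPowerSeries (Fin n) ℂ, (∀ j, CConv (b j)) ∧ f = ∑ j, b j * G j}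

lemma cJ_zero {n m : ℕ} (G : Fin m → MvPowerSeries (Fin n) ℂ) : 0 ∈ cJ G :=
  ⟨fun _ => 0, fun _ => CConv.zero, by simp⟩

lemma cJ_add {n m : ℕ} (G : Fin m → MvPowerSeries (Fin n) ℂ) :
    ∀ f ∈ cJ G, ∀ g ∈ cJ G, f + g ∈ cJ G := by
  rintro _ ⟨b, hb, rfl⟩ _ ⟨b', hb', rfl⟩
  exact ⟨fun j => b j + b' j, fun j => (hb j).add (hb' j), by
    simp only [add_mul, Finset.sum_add_distrib]⟩

lemma cJ_mul {n m : ℕ} (G : Fin m → MvPowerSeries (Fin n) ℂ) :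
    ∀ a, CConv a → ∀ f ∈ cJ G, a * f ∈ cJ G := by
  rintro a ha _ ⟨b, hb, rfl⟩
  exact ⟨fun j => a * b j, fun j => ha.mul (hb j), by
    simp only [Finset.mul_sum, mul_assoc]⟩

lemma cJ_conv {n m : ℕ} {G : Fin m → MvPowerSeries (Fin n) ℂ} (hG : ∀ j, CConv (G j)) :
    ∀ f ∈ cJ G, CConv f := by
  rintro _ ⟨b, hb, rfl⟩
  exact CConv.sum fun j _ => (hb j).mul (hG j)

lemma cJ_lim {n m : ℕ} {G : Fin m → MvPowerSeries (Fin n) ℂ}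
    {H : ℕ → MvPowerSeries (Fin n) ℂ} (hH : ∀ k, H k ∈ cJ G) {F : MvPowerSeries (Fin n) ℂ}
    (hlim : ∀ β, Tendsto (fun k => MvPowerSeries.coeff β (H k)) atTop
      (𝓝 (MvPowerSeries.coeff β F))) (K : ℕ) :
    ∃ i ∈ cJ G, ∀ β, cNN β < K → MvPowerSeries.coeff β F = MvPowerSeries.coeff β i := by
  have hfin : Finite {β : Fin n →₀ ℕ // cNN β < K} := (cNN_finite K).to_subtype
  have := Fintype.ofFinite {β : Fin n →₀ ℕ // cNN β < K}
  let T : MvPowerSeries (Fin n) ℂ → ({β : Fin n →₀ ℕ // cNN β < K} → ℂ) :=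
    fun f β => MvPowerSeries.coeff β.1 f
  let S : Submodule ℂ ({β : Fin n →₀ ℕ // cNN β < K} → ℂ) :=
    { carrier := T '' cJ G
      zero_mem' := ⟨0, cJ_zero G, by funext β; simp [T]⟩
      add_mem' := by
        rintro _ _ ⟨f, hf, rfl⟩ ⟨g, hg, rfl⟩
        exact ⟨f + g, cJ_add G f hf g hg, by funext β; simp [T]⟩
      smul_mem' := by
        rintro c _ ⟨f, hf, rfl⟩
        refine ⟨MvPowerSeries.monomial 0 c * f, cJ_mul G _ (CConv.monomial _ _) f hf, ?_⟩
        funext β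
        simp [T, MvPowerSeries.monomial_zero_eq_C_apply] }
  have hcl : IsClosed (S : Set ({β : Fin n →₀ ℕ // cNN β < K} → ℂ)) :=
    S.closed_of_finiteDimensional
  have ht : Tendsto (fun k => T (H k)) atTop (𝓝 (T F)) :=
    tendsto_pi_nhds.2 fun β => hlim β.1
  have hmem : T F ∈ (S : Set ({β : Fin n →₀ ℕ // cNN β < K} → ℂ)) :=
    hcl.mem_of_tendsto ht (Eventually.of_forall fun k => ⟨H k, hH k, rfl⟩)
  obtain ⟨i, hi, hiF⟩ := hmem
  exact ⟨i, hi, fun β hβ => (congrFun hiF ⟨β, hβ⟩).symm⟩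

end CartanAux5

/-- Cartan's closedness theorem, special case: let `I` be the ideal of the ring
of holomorphic germs at `0 ∈ ℂⁿ` generated by `g₁, …, g_m`, let `V` be a polydisc
neighbourhood of `0`, and let `(h_k)` be holomorphic functions on `V` whose germs at `0`
lie in `I`, converging locally uniformly on `V` to a holomorphic `h`.  Then the germ of
`h` at `0` lies in `I`. -/
theorem stmt_5 (n m : ℕ) (g : Fin m → ((Fin n → ℂ) → ℂ)) (hg : ∀ j, AnalyticAt ℂ (g j) 0)
    (R : Fin n → ℝ) (hR : ∀ i, 0 < R i)
    (V : Set (Fin n → ℂ)) (hV : V = {z : Fin n → ℂ | ∀ i, ‖z i‖ < R i})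
    (hk : ℕ → ((Fin n → ℂ) → ℂ)) (h : (Fin n → ℂ) → ℂ)
    (hol : ∀ k, DifferentiableOn ℂ (hk k) V) (holh : DifferentiableOn ℂ h V)
    (hmem : ∀ k, MemIdealGerm g (hk k))
    (hconv : TendstoLocallyUniformlyOn hk h atTop V) :
    MemIdealGerm g h := by
  obtain ⟨r, hr, hrR⟩ : ∃ r : ℝ, 0 < r ∧ ∀ i, r < R i := by
    have h1 : ∀ᶠ r in 𝓝[>] (0 : ℝ), ∀ i, r < R i := by
      rw [Filter.eventually_all]
      exact fun i => (eventually_lt_nhds (hR i)).filter_mono nhdsWithin_le_nhds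
    obtain ⟨r, h2, h3⟩ := (h1.and self_mem_nhdsWithin).exists
    exact ⟨r, h3, h2⟩
  have hVo : IsOpen V := by
    rw [hV]
    simp only [ofPred_forall]
    exact isOpen_iInter_of_finite fun i => isOpen_lt (by fun_prop) continuous_const
  have hsub : {z : Fin n → ℂ | ∀ i, ‖z i‖ ≤ r} ⊆ V := by
    rw [hV]
    exact fun z hz i => (hz i).trans_lt (hrR i)
  have hK : IsCompact {z : Fin n → ℂ | ∀ i, ‖z i‖ ≤ r} := by
    rw [cpoly_eq hr]; exact isCompact_closedBall _ _
  have hd : ∀ f : (Fin n → ℂ) → ℂ, DifferentiableOn ℂ f V →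
      ∀ z : Fin n → ℂ, (∀ i, ‖z i‖ ≤ r) → DifferentiableAt ℂ f z :=
    fun f hf z hz => hf.differentiableAt (hVo.mem_nhds (hsub hz))
  have hunif : TendstoUniformlyOn hk h atTop {z : Fin n → ℂ | ∀ i, ‖z i‖ ≤ r} :=
    (tendstoLocallyUniformlyOn_iff_tendstoUniformlyOn_of_compact hK).1 (hconv.mono hsub)
  choose G hG using fun j => crep_of_analytic (hg j)
  obtain ⟨F, hF⟩ := crep_of_diff' hr (hd h holh)
  choose H hH using fun k => crep_of_diff' hr (hd (hk k) (hol k))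
  have hHJ : ∀ k, H k ∈ cJ G := by
    intro k
    obtain ⟨a, ha, hae⟩ := hmem k
    choose b hb using fun j => crep_of_analytic (ha j)
    refine ⟨b, fun j => (hb j).1, ?_⟩
    exact ((hH k)).unique ((CRep.sum Finset.univ fun j _ => (hb j).mul (hG j)).congr hae)
  have hlim : ∀ β, Tendsto (fun k => MvPowerSeries.coeff β (H k)) atTop
      (𝓝 (MvPowerSeries.coeff β F)) := by
    intro β
    rw [Metric.tendsto_atTop']
    intro ε hε
    have hρ : 0 < r ^ (∑ i, β i) := pow_pos hr _
    have hu := Metric.tendstoUniformlyOn_iff.1 hunif (ε / 2 * r ^ (∑ i, β i)) (by positivity)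
    obtain ⟨N, hN⟩ := eventually_atTop.1 hu
    refine ⟨N, fun k hkN => ?_⟩
    obtain ⟨c, hc, hcb⟩ := crep_of_diff hr (f := fun z => hk k z - h z)
      (M := ε / 2 * r ^ (∑ i, β i))
      (fun z hz => (hd _ (hol k) z hz).sub (hd _ holh z hz))
      (fun z hz => by
        have := hN k hkN.le z hz
        rw [dist_comm, dist_eq_norm] at this
        exact this.le)
    have hce : c = H k - F := hc.unique ((hH k).sub hF)
    have h1 := le_of_mul_le_mul_right (hcb β) hρ
    rw [hce, map_sub] at h1
    rw [dist_eq_norm]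
    linarith
  have hFJ : F ∈ cJ G := cclosed (cJ G) (cJ_zero G) (cJ_add G) (cJ_mul G)
    (cJ_conv fun j => (hG j).1) F hF.1 (cJ_lim hHJ hlim)
  obtain ⟨b, hb, hFb⟩ := hFJ
  choose a ha hab using fun j => canalytic (hb j)
  refine ⟨a, ha, ?_⟩
  have h2 := CRep.sum Finset.univ fun j _ => (hab j).mul (hG j)
  rw [← hFb] at h2
  filter_upwards [hF.2, h2.2] with z h3 h4
  exact h3.unique h4
end

section
/- Let F(x,t) = f₀(x) + Σ_{j≥1} t^j f_j(x) be a convergent power series in (x,t) ∈ ℂⁿ × ℂ with all f_j(0) = 0, and let I be an ideal of the ring of holomorphic germs at 0 ∈ ℂⁿ. Assume that for every i and every t in a sequence t_k → 0, t_k ≠ 0, the germ x ↦ (∂F/∂xᵢ)(x, t_k) lies in I. Then ∂f_j/∂xᵢ ∈ I for every j ≥ 0 and every i. -/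
open Filter Metric Set Topology

namespace Stm6

/-- Monomials. -/
def mon {ι : Type*} [Fintype ι] (α : ι → ℕ) (x : ι → ℂ) : ℂ := ∏ i, x i ^ α i

theorem mon_add {ι : Type*} [Fintype ι] (α β : ι → ℕ) (x : ι → ℂ) :
    mon (α + β) x = mon α x * mon β x := by
  simp [mon, pow_add, Finset.prod_mul_distrib]

theorem norm_mon_le {ι : Type*} [Fintype ι] (α : ι → ℕ) (x : ι → ℂ) (r : ℝ)
    (h : ∀ i, ‖x i‖ ≤ r) : ‖mon α x‖ ≤ r ^ (∑ i, α i) := by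
  rw [mon, norm_prod, ← Finset.prod_pow_eq_pow_sum]
  refine Finset.prod_le_prod (fun i _ => norm_nonneg _) fun i _ => ?_
  rw [norm_pow]
  exact pow_le_pow_left₀ (norm_nonneg _) (h i) _

/-- one-variable uniqueness -/
theorem coeff_zero (c : ℕ → ℂ) (s : ℂ → ℂ)
    (hs : ∀ᶠ t in 𝓝 (0 : ℂ), HasSum (fun j => t ^ j * c j) (s t))
    (hf : ∃ᶠ t in 𝓝[≠] (0 : ℂ), s t = 0) (j : ℕ) : c j = 0 := by
  have hp : HasFPowerSeriesAt s (FormalMultilinearSeries.ofScalars ℂ c) 0 := by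
    rw [hasFPowerSeriesAt_iff]
    simpa [FormalMultilinearSeries.coeff_ofScalars] using hs
  have h0 := (hp.analyticAt.frequently_zero_iff_eventually_zero).1 hf
  have := hp.eq_zero_of_eventually h0
  have h2 := congrArg (fun p => FormalMultilinearSeries.coeff p j) this
  simp only [FormalMultilinearSeries.coeff_ofScalars] at h2
  rw [h2]
  rfl

theorem coeff_unique (a b : ℕ → ℂ) (s : ℂ → ℂ)
    (ha : ∀ᶠ t in 𝓝 (0 : ℂ), HasSum (fun j => t ^ j * a j) (s t))
    (hb : ∀ᶠ t in 𝓝 (0 : ℂ), HasSum (fun j => t ^ j * b j) (s t)) (j : ℕ) : a j = b j := by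
  have := coeff_zero (fun j => a j - b j) (fun _ => 0) (by
    filter_upwards [ha, hb] with t h1 h2
    simpa [mul_sub] using h1.sub h2) (Eventually.frequently (Eventually.of_forall fun _ => rfl)) j
  exact sub_eq_zero.1 this

theorem exists_word {ι : Type*} [Fintype ι] (α : ι → ℕ) (k : ℕ) (hk : ∑ i, α i = k) :
    ∃ v : Fin k → ι, ∀ x : ι → ℂ, ∏ j, x (v j) = mon α x := by
  classical
  set s : Multiset ι := ∑ i, α i • {i} with hs
  have hc : s.toList.length = k := by
    rw [Multiset.length_toList, hs, Multiset.card_sum]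
    simpa using hk
  subst hc
  refine ⟨fun j => s.toList.get j, fun x => ?_⟩
  have h1 : ∏ j, x (s.toList.get j) = (s.toList.map x).prod := by
    rw [← List.prod_ofFn]
    congr 1
    apply List.ext_get <;> simp
  rw [h1]
  have h2 : (s.toList.map x).prod = (s.map x).prod := by
    conv_rhs => rw [← Multiset.coe_toList s]
    rw [Multiset.map_coe, Multiset.prod_coe]
  have h3 : Multiset.map x (∑ i, α i • ({i} : Multiset ι)) =
      ∑ i, Multiset.map x (α i • ({i} : Multiset ι)) :=
    map_sum (Multiset.mapAddMonoidHom x) _ _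
  rw [h2, hs, h3, Multiset.prod_sum, mon]
  refine Finset.prod_congr rfl fun i _ => ?_
  rw [Multiset.map_nsmul, Multiset.prod_nsmul]
  simp

theorem exists_mlin {ι : Type*} [Fintype ι] (k : ℕ) (α : ι → ℕ) :
    ∃ m : ContinuousMultilinearMap ℂ (fun _ : Fin k => (ι → ℂ)) ℂ, ‖m‖ ≤ 1 ∧
      (∑ i, α i = k → ∀ x, m (fun _ => x) = mon α x) := by
  by_cases hk : ∑ i, α i = k
  · obtain ⟨v, hv⟩ := exists_word α k hk
    refine ⟨(ContinuousMultilinearMap.mkPiAlgebraFin ℂ k ℂ).compContinuousLinearMap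
      (fun j => ContinuousLinearMap.proj (v j)), ?_, fun _ x => ?_⟩
    · refine ContinuousMultilinearMap.opNorm_le_bound zero_le_one fun y => ?_
      simp only [ContinuousMultilinearMap.compContinuousLinearMap_apply,
        ContinuousMultilinearMap.mkPiAlgebraFin_apply, List.prod_ofFn, one_mul,
        ContinuousLinearMap.proj_apply, norm_prod]
      exact Finset.prod_le_prod (fun i _ => norm_nonneg _) fun i _ => norm_le_pi_norm _ _
    · simp [List.prod_ofFn, hv]
  · exact ⟨0, by simp, fun h => absurd h hk⟩

theorem analytic_tsum {ι : Type*} [Fintype ι] (a : (ι → ℕ) → ℂ) (ρ : ℝ) (hρ : 0 < ρ)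
    (ha : Summable fun α => ‖a α‖ * ρ ^ (∑ i, α i)) :
    AnalyticOnNhd ℂ (fun x : ι → ℂ => ∑' α, a α * mon α x) (ball 0 ρ) := by
  classical
  choose m hm1 hm2 using fun k (α : ι → ℕ) => exists_mlin k α
  let p : FormalMultilinearSeries ℂ (ι → ℂ) ℂ := fun k =>
    ∑ α ∈ Finset.piAntidiag Finset.univ k, a α • m k α
  have hfib : ∀ (k : ℕ), (fun α : ι → ℕ => ∑ i, α i) ⁻¹' {k} =
      ((Finset.piAntidiag Finset.univ k : Finset (ι → ℕ)) : Set (ι → ℕ)) := by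
    intro k; ext α; simp
  have hsum := ha.hasSum.tsum_fiberwise (fun α : ι → ℕ => ∑ i, α i)
  have hpn : ∀ k, ‖p k‖ * ρ ^ k ≤ ∑' α, ‖a α‖ * ρ ^ (∑ i, α i) := by
    intro k
    calc ‖p k‖ * ρ ^ k ≤ (∑ α ∈ Finset.piAntidiag Finset.univ k, ‖a α‖) * ρ ^ k := by
          gcongr
          refine (norm_sum_le _ _).trans (Finset.sum_le_sum fun α _ => ?_)
          rw [norm_smul]
          exact mul_le_of_le_one_right (norm_nonneg _) (hm1 _ _)
      _ = ∑ α ∈ Finset.piAntidiag Finset.univ k, ‖a α‖ * ρ ^ (∑ i, α i) := by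
          rw [Finset.sum_mul]
          refine Finset.sum_congr rfl fun α h => ?_
          rw [Finset.mem_piAntidiag] at h
          rw [h.1]
      _ ≤ _ := ha.sum_le_tsum _ (fun α _ => by positivity)
  have hrad : ENNReal.ofReal ρ ≤ p.radius := by
    have := p.le_radius_of_bound (r := ⟨ρ, hρ.le⟩) _ hpn
    convert this
    rw [ENNReal.ofReal]
    congr 1
    exact Subtype.ext (by simp [hρ.le])
  have hball : HasFPowerSeriesOnBall (fun x : ι → ℂ => ∑' α, a α * mon α x) p 0
      (ENNReal.ofReal ρ) := by
    refine ⟨hrad, by simpa using hρ, fun {y} hy => ?_⟩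
    have hy' : ∀ i, ‖y i‖ ≤ ρ := by
      rw [Metric.eball_ofReal] at hy
      intro i
      exact (norm_le_pi_norm y i).trans (by simpa using (mem_ball_zero_iff.1 hy).le)
    have hs : Summable fun α => a α * mon α y := by
      refine Summable.of_norm_bounded ha fun α => ?_
      rw [norm_mul]
      gcongr
      exact norm_mon_le _ _ _ hy'
    have h := hs.hasSum.tsum_fiberwise (fun α : ι → ℕ => ∑ i, α i)
    rw [zero_add]
    convert! h using 2 with k
    rw [hfib k, Finset.tsum_subtype' (Finset.piAntidiag Finset.univ k) (fun α => a α * mon α y)]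
    simp only [p, sum_apply, smul_apply,
      smul_eq_mul]
    refine Finset.sum_congr rfl fun α h => ?_
    rw [Finset.mem_piAntidiag] at h
    rw [hm2 k α h.1]
  have := hball.analyticOnNhd
  rwa [Metric.eball_ofReal] at this

theorem exists_expansion {ι E : Type*} [Fintype ι] [NormedAddCommGroup E] [NormedSpace ℂ E]
    (h : E → ℂ) (hh : AnalyticAt ℂ h 0) (b : ι → E) (hb : ∀ i, ‖b i‖ ≤ 1) :
    ∃ (a : (ι → ℕ) → ℂ) (r : ℝ), 0 < r ∧ Summable (fun α => ‖a α‖ * r ^ (∑ i, α i)) ∧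
      ∀ x : ι → ℂ, (∀ i, ‖x i‖ ≤ r) → HasSum (fun α => a α * mon α x) (h (∑ i, x i • b i)) := by
  classical
  obtain ⟨p, R, hp⟩ := hh
  obtain ⟨R', hR'0, hR'⟩ := ENNReal.lt_iff_exists_nnreal_btwn.1 hp.r_pos
  have hR'pos : (0 : ℝ) < R' := by exact_mod_cast hR'0
  set K : ℝ := Fintype.card ι + 1 with hK
  have hKpos : 0 < K := by positivity
  set r : ℝ := R' / K with hr
  have hrpos : 0 < r := by positivity
  let S := Σ k : ℕ, (Fin k → ι)
  let c : S → ℂ := fun v => p v.1 (fun j => b (v.2 j))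
  let ct : S → (ι → ℕ) := fun v i => (Finset.univ.filter fun j => v.2 j = i).card
  have hct : ∀ v : S, ∑ i, ct v i = v.1 := by
    intro v
    have := Finset.card_eq_sum_card_fiberwise (f := v.2) (s := Finset.univ) (t := Finset.univ)
      (fun _ _ => Finset.mem_coe.2 (Finset.mem_univ _))
    simpa [ct] using this.symm
  have hmon : ∀ (v : S) (x : ι → ℂ), mon (ct v) x = ∏ j, x (v.2 j) := by
    intro v x
    rw [mon, ← Finset.prod_fiberwise Finset.univ v.2 (fun j => x (v.2 j))]
    refine Finset.prod_congr rfl fun i _ => ?_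
    rw [Finset.prod_congr rfl (g := fun _ => x i) (fun j hj => by
      rw [(Finset.mem_filter.1 hj).2]), Finset.prod_const]
  have hcb : ∀ v : S, ‖c v‖ ≤ ‖p v.1‖ := by
    intro v
    refine (ContinuousMultilinearMap.le_opNorm _ _).trans ?_
    refine mul_le_of_le_one_right (norm_nonneg _) ?_
    exact Finset.prod_le_one (fun _ _ => norm_nonneg _) fun _ _ => hb _
  have hps : Summable fun k => ‖p k‖ * (R' : ℝ) ^ k :=
    p.summable_norm_mul_pow (hR'.trans_le hp.r_le)
  have hS : Summable fun v : S => ‖c v‖ * r ^ v.1 := by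
    rw [summable_sigma_of_nonneg (fun v => by positivity)]
    refine ⟨fun k => (hasSum_fintype _).summable, ?_⟩
    refine Summable.of_nonneg_of_le (fun k => tsum_nonneg fun _ => by positivity) (fun k => ?_) hps
    rw [tsum_fintype]
    calc ∑ v : Fin k → ι, ‖c ⟨k, v⟩‖ * r ^ k ≤ ∑ v : Fin k → ι, ‖p k‖ * r ^ k := by
          gcongr with v
          exact hcb ⟨k, v⟩
      _ = (Fintype.card ι : ℝ) ^ k * (‖p k‖ * r ^ k) := by
          simp [Finset.sum_const]
      _ ≤ K ^ k * (‖p k‖ * r ^ k) := by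
          gcongr
          simp [hK]
      _ = ‖p k‖ * (R' : ℝ) ^ k := by
          rw [hr, div_pow]
          field_simp
  have hcs : ∀ α, Summable fun v : ct ⁻¹' {α} => ‖c v‖ := by
    intro α
    have h1 := hS.subtype (ct ⁻¹' {α})
    have h2 := h1.mul_right ((r ^ (∑ i, α i))⁻¹)
    refine h2.congr fun v => ?_
    have : ct v.1 = α := v.2
    simp only [Function.comp]
    rw [← hct, this]
    field_simp
  refine ⟨fun α => ∑' v : ct ⁻¹' {α}, c v, r, hrpos, ?_, ?_⟩
  · have h := hS.hasSum.tsum_fiberwise ct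
    refine Summable.of_nonneg_of_le (fun α => by positivity) (fun α => ?_) h.summable
    calc ‖∑' v : ct ⁻¹' {α}, c v‖ * r ^ (∑ i, α i)
        ≤ (∑' v : ct ⁻¹' {α}, ‖c v‖) * r ^ (∑ i, α i) := by
          gcongr
          exact norm_tsum_le_tsum_norm (hcs α)
      _ = _ := by
          rw [← tsum_mul_right]
          refine tsum_congr fun v => ?_
          have : ct v.1 = α := v.2
          rw [← hct, this]
  · intro x hx
    have hxs : Summable fun v : S => c v * mon (ct v) x := by
      refine Summable.of_norm_bounded hS fun v => ?_
      rw [norm_mul]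
      gcongr
      rw [← hct v]
      exact norm_mon_le _ _ _ hx
    have h1 := hxs.hasSum.tsum_fiberwise ct
    have h2 : ∀ α, ∑' v : ct ⁻¹' {α}, c v * mon (ct v) x
        = (∑' v : ct ⁻¹' {α}, c v) * mon α x := by
      intro α
      rw [← tsum_mul_right]
      refine tsum_congr fun v => ?_
      have : ct v.1 = α := v.2
      rw [this]
    simp only [h2] at h1
    have h3 := hxs.hasSum.sigma (g := fun k => p k (fun _ => ∑ i, x i • b i)) (fun k => by
      have : p k (fun _ => ∑ i, x i • b i) = ∑ v : Fin k → ι, c ⟨k, v⟩ * mon (ct ⟨k, v⟩) x := by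
        rw [ContinuousMultilinearMap.map_sum]
        refine Finset.sum_congr rfl fun v _ => ?_
        rw [ContinuousMultilinearMap.map_smul_univ, hmon, smul_eq_mul, mul_comm]
      rw [this]
      exact hasSum_fintype _)
    have h4 := hp.hasSum (y := ∑ i, x i • b i) (by
      rw [mem_eball_zero_iff]
      refine lt_of_le_of_lt ?_ hR'
      have : ‖∑ i, x i • b i‖ ≤ R' := by
        calc ‖∑ i, x i • b i‖ ≤ ∑ i : ι, r := by
              refine (norm_sum_le _ _).trans (Finset.sum_le_sum fun i _ => ?_)
              rw [norm_smul]
              exact (mul_le_of_le_one_right (norm_nonneg _) (hb i)).trans (hx i)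
          _ = Fintype.card ι * r := by simp
          _ ≤ K * r := by gcongr; simp [hK]
          _ = R' := by rw [hr]; field_simp
      exact_mod_cast (show ‖∑ i, x i • b i‖₊ ≤ R' from this))
    rw [zero_add] at h4
    rw [h4.unique h3]
    exact h1

end Stm6


namespace Stm6

/-- Weights: the primes. -/
noncomputable def pr (i : ℕ) : ℕ := Nat.nth Nat.Prime i

theorem pr_prime (i : ℕ) : (pr i).Prime := Nat.prime_nth_prime i

theorem pr_inj : Function.Injective pr := Nat.nth_injective Nat.infinite_setOfPred_prime

/-- The integer attached to a multi-index. -/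
noncomputable def NN {n : ℕ} (α : Fin n → ℕ) : ℕ := ∏ i : Fin n, pr i ^ α i

theorem NN_pos {n : ℕ} (α : Fin n → ℕ) : 0 < NN α :=
  Finset.prod_pos fun i _ => pow_pos (pr_prime i).pos _

theorem NN_add {n : ℕ} (α β : Fin n → ℕ) : NN (α + β) = NN α * NN β := by
  simp [NN, pow_add, Finset.prod_mul_distrib]

theorem NN_inj {n : ℕ} : Function.Injective (NN (n := n)) := by
  have key : ∀ (α : Fin n → ℕ) (j : Fin n), (NN α).factorization (pr j) = α j := by
    intro α j
    rw [NN, Nat.factorization_prod_apply (fun (i : Fin n) _ => pow_ne_zero _ (pr_prime i).ne_zero)]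
    rw [Finset.sum_eq_single j]
    · rw [(pr_prime j).factorization_pow]; simp
    · intro i _ hij
      rw [(pr_prime i).factorization_pow, Finsupp.single_apply, if_neg]
      intro h
      exact hij (Fin.ext (pr_inj h))
    · simp
  intro α β h
  funext j
  rw [← key α j, ← key β j, h]

/-- The weight of a monomial. -/
noncomputable def ww {n : ℕ} (σ : ℕ) (α : Fin n → ℕ) : ℝ := ((NN α : ℝ) ^ σ)⁻¹

theorem ww_pos {n : ℕ} (σ : ℕ) (α : Fin n → ℕ) : 0 < ww σ α := by
  have : (0 : ℝ) < NN α := by exact_mod_cast NN_pos α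
  unfold ww; positivity

theorem ww_add {n : ℕ} (σ : ℕ) (α β : Fin n → ℕ) : ww σ (α + β) = ww σ α * ww σ β := by
  simp [ww, NN_add, mul_pow, mul_comm]

theorem ww_eq_prod {n : ℕ} (σ : ℕ) (α : Fin n → ℕ) :
    ww σ α = ∏ i : Fin n, (((pr i : ℝ) ^ σ)⁻¹) ^ α i := by
  simp only [ww, NN, Nat.cast_prod, Nat.cast_pow, ← Finset.prod_pow, ← Finset.prod_inv_distrib]
  refine Finset.prod_congr rfl fun i _ => ?_
  rw [inv_pow, ← pow_mul, ← pow_mul, mul_comm]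

/-- The closed polydisc with radii `p_i ^ (-σ)`. -/
def PP (n σ : ℕ) : Set (Fin n → ℂ) := {x | ∀ i, ‖x i‖ ≤ ((pr i : ℝ) ^ σ)⁻¹}

theorem pr_rad_pos (i σ : ℕ) : 0 < ((pr i : ℝ) ^ σ)⁻¹ := by
  have : (0 : ℝ) < pr i := by exact_mod_cast (pr_prime i).pos
  positivity

theorem PP_nhds (n σ : ℕ) : ∀ᶠ x in 𝓝 (0 : Fin n → ℂ), x ∈ PP n σ := by
  simp only [PP, mem_ofPred_eq, eventually_all]
  intro i
  have : Tendsto (fun x : Fin n → ℂ => ‖x i‖) (𝓝 0) (𝓝 0) := by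
    have : Continuous fun x : Fin n → ℂ => ‖x i‖ := by fun_prop
    simpa using this.tendsto 0
  exact this.eventually (ge_mem_nhds (pr_rad_pos i σ))

theorem mon_le_ww {n σ : ℕ} {x : Fin n → ℂ} (hx : x ∈ PP n σ) (α : Fin n → ℕ) :
    ‖mon α x‖ ≤ ww σ α := by
  rw [mon, norm_prod, ww_eq_prod]
  refine Finset.prod_le_prod (fun i _ => norm_nonneg _) fun i _ => ?_
  rw [norm_pow]
  exact pow_le_pow_left₀ (norm_nonneg _) (hx i) _

theorem ww_le_pow {n σ : ℕ} {r : ℝ} (hr : ((2 : ℝ) ^ σ)⁻¹ ≤ r) (α : Fin n → ℕ) :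
    ww σ α ≤ r ^ (∑ i, α i) := by
  rw [ww_eq_prod, ← Finset.prod_pow_eq_pow_sum]
  refine Finset.prod_le_prod (fun i _ => (pow_pos (pr_rad_pos i σ) _).le) fun i _ => ?_
  refine pow_le_pow_left₀ (pr_rad_pos i σ).le (le_trans ?_ hr) _
  have : (2 : ℝ) ≤ pr i := by exact_mod_cast (pr_prime i).two_le
  gcongr

theorem exists_pow_le_ww (n σ : ℕ) : ∃ ρ : ℝ, 0 < ρ ∧ ∀ α : Fin n → ℕ,
    ρ ^ (∑ i, α i) ≤ ww σ α := by
  refine ⟨∏ i : Fin n, ((pr i : ℝ) ^ σ)⁻¹, Finset.prod_pos fun i _ => pr_rad_pos i σ, fun α => ?_⟩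
  have h1 : ∀ i : ℕ, ((pr i : ℝ) ^ σ)⁻¹ ≤ 1 := by
    intro i
    apply inv_le_one_of_one_le₀
    exact one_le_pow₀ (by exact_mod_cast (pr_prime i).one_le)
  rw [ww_eq_prod, ← Finset.prod_pow_eq_pow_sum]
  have hpos : 0 < ∏ i : Fin n, ((pr i : ℝ) ^ σ)⁻¹ := Finset.prod_pos fun i _ => pr_rad_pos i σ
  refine Finset.prod_le_prod (fun i _ => (pow_pos hpos _).le) fun i _ => ?_
  refine pow_le_pow_left₀ hpos.le ?_ _
  rw [← Finset.mul_prod_erase _ _ (Finset.mem_univ i)]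
  exact mul_le_of_le_one_right (pr_rad_pos i σ).le
    (Finset.prod_le_one (fun j _ => (pr_rad_pos j σ).le) fun j _ => h1 j)

/-- The Banach space of absolutely summable families. -/
noncomputable abbrev XX (n : ℕ) := lp (fun _ : (Fin n → ℕ) => ℂ) 1

theorem XX_hasSum_norm {n : ℕ} (u : XX n) : HasSum (fun α => ‖u α‖) ‖u‖ := by
  have := lp.hasSum_norm (p := 1) (by simp) u
  simpa using this

theorem XX_of_summable {n : ℕ} (a : (Fin n → ℕ) → ℂ) (h : Summable fun α => ‖a α‖) :
    ∃ u : XX n, ∀ α, u α = a α :=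
  ⟨⟨a, memℓp_gen (by simpa using h)⟩, fun _ => rfl⟩

/-- Basis vectors. -/
noncomputable def ee {n : ℕ} (α : Fin n → ℕ) : XX n := by
  classical exact lp.single 1 α 1

theorem ee_apply {n : ℕ} (α β : Fin n → ℕ) :
    (ee α : XX n) β = if β = α then 1 else 0 := by
  unfold ee
  rw [lp.single_apply]
  simp only [Pi.single_apply]

theorem norm_ee {n : ℕ} (α : Fin n → ℕ) : ‖(ee α : XX n)‖ = 1 := by
  unfold ee
  rw [lp.norm_single (by simp)]
  simp

theorem hasSum_ee {n : ℕ} (u : XX n) : HasSum (fun α => u α • ee α) u := by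
  classical
  have := lp.hasSum_single (p := 1) (by simp) u
  convert! this using 2 with α
  unfold ee
  rw [← lp.single_smul]
  simp

theorem XX_ext {n : ℕ} {Y : Type*} [NormedAddCommGroup Y] [NormedSpace ℂ Y]
    (S T : XX n →L[ℂ] Y) (h : ∀ α, S (ee α) = T (ee α)) (u : XX n) : S u = T u := by
  have h1 := S.hasSum (hasSum_ee u)
  have h2 := T.hasSum (hasSum_ee u)
  simp only [map_smul, h] at h1 h2
  exact h1.unique h2

theorem exists_op {n : ℕ} {Y : Type*} [NormedAddCommGroup Y] [NormedSpace ℂ Y] [CompleteSpace Y]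
    (v : (Fin n → ℕ) → Y) (C : ℝ) (hC : 0 ≤ C) (hv : ∀ α, ‖v α‖ ≤ C) :
    ∃ T : XX n →L[ℂ] Y, (∀ α, T (ee α) = v α) ∧ ‖T‖ ≤ C := by
  classical
  have hs : ∀ u : XX n, Summable fun α => ‖u α • v α‖ := by
    intro u
    refine Summable.of_nonneg_of_le (fun _ => norm_nonneg _) (fun α => ?_)
      ((XX_hasSum_norm u).summable.mul_right C)
    rw [norm_smul]
    gcongr
    exact hv α
  let L : XX n →ₗ[ℂ] Y :=
    { toFun := fun u => ∑' α, u α • v α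
      map_add' := by
        intro u w
        rw [← (hs u).of_norm.tsum_add (hs w).of_norm]
        simp [add_smul]
      map_smul' := by
        intro c u
        simp only [RingHom.id_apply]
        rw [← tsum_const_smul'']
        simp [mul_smul] }
  have hL : ∀ u, ‖L u‖ ≤ C * ‖u‖ := by
    intro u
    refine tsum_of_norm_bounded ((XX_hasSum_norm u).mul_left C) fun α => ?_
    rw [norm_smul, mul_comm]
    gcongr
    exact hv α
  refine ⟨L.mkContinuous C hL, fun α => ?_, L.mkContinuous_norm_le hC hL⟩
  change ∑' β, (ee α : XX n) β • v β = v α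
  rw [tsum_eq_single α (fun β hb => by simp [ee_apply, hb])]
  simp [ee_apply]

/-- The function associated with a vector. -/
noncomputable def evf {n : ℕ} (σ : ℕ) (u : XX n) (x : Fin n → ℂ) : ℂ :=
  ∑' α, (u α / ww σ α) * mon α x

theorem exists_ev {n σ : ℕ} {x : Fin n → ℂ} (hx : x ∈ PP n σ) :
    ∃ L : XX n →L[ℂ] ℂ, (∀ α, L (ee α) = mon α x / ww σ α) ∧ ‖L‖ ≤ 1 ∧
      ∀ u, L u = evf σ u x := by
  obtain ⟨L, hL, hL1⟩ := exists_op (Y := ℂ) (fun α => mon α x / ww σ α) 1 zero_le_one (fun α => by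
    rw [norm_div, Complex.norm_real, Real.norm_of_nonneg (ww_pos σ α).le,
      div_le_one (ww_pos σ α)]
    exact mon_le_ww hx α)
  refine ⟨L, hL, hL1, fun u => ?_⟩
  have h1 := L.hasSum (hasSum_ee u)
  simp only [map_smul, hL, smul_eq_mul] at h1
  rw [← h1.tsum_eq, evf]
  refine tsum_congr fun α => ?_
  ring

theorem evf_analytic (n : ℕ) (σ : ℕ) :
    ∃ ρ > 0, ∀ u : XX n, AnalyticOnNhd ℂ (evf σ u) (ball 0 ρ) := by
  obtain ⟨ρ, hρ, h⟩ := exists_pow_le_ww n σ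
  refine ⟨ρ, hρ, fun u => analytic_tsum (fun α => u α / ww σ α) ρ hρ ?_⟩
  refine Summable.of_nonneg_of_le (fun _ => by positivity) (fun α => ?_)
    (XX_hasSum_norm u).summable
  rw [norm_div, Complex.norm_real, Real.norm_of_nonneg (ww_pos σ α).le, div_mul_eq_mul_div,
    div_le_iff₀ (ww_pos σ α)]
  gcongr
  exact h α

theorem evf_analyticAt {n : ℕ} (σ : ℕ) (u : XX n) : AnalyticAt ℂ (evf σ u) 0 := by
  obtain ⟨ρ, hρ, h⟩ := evf_analytic n σ
  exact h u 0 (mem_ball_self hρ)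

/-! ideal membership -/

theorem mem_congr {n m : ℕ} {g : Fin m → ((Fin n → ℂ) → ℂ)} {h h' : (Fin n → ℂ) → ℂ}
    (hm : MemIdealGerm g h) (he : ∀ᶠ x in 𝓝 0, h' x = h x) : MemIdealGerm g h' := by
  obtain ⟨a, ha, hz⟩ := hm
  refine ⟨a, ha, ?_⟩
  filter_upwards [hz, he] with x h1 h2
  rw [h2, h1]

theorem mem_mul {n m : ℕ} {g : Fin m → ((Fin n → ℂ) → ℂ)} {h q : (Fin n → ℂ) → ℂ}
    (hq : AnalyticAt ℂ q 0) (hm : MemIdealGerm g h) : MemIdealGerm g (fun x => q x * h x) := by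
  obtain ⟨a, ha, hz⟩ := hm
  refine ⟨fun j x => q x * a j x, fun j => hq.mul (ha j), ?_⟩
  filter_upwards [hz] with x h1
  rw [h1, Finset.mul_sum]
  simp [mul_assoc]

theorem mem_add {n m : ℕ} {g : Fin m → ((Fin n → ℂ) → ℂ)} {h q : (Fin n → ℂ) → ℂ}
    (hq : MemIdealGerm g q) (hm : MemIdealGerm g h) : MemIdealGerm g (fun x => q x + h x) := by
  obtain ⟨a, ha, hz⟩ := hm
  obtain ⟨b, hb, hw⟩ := hq
  refine ⟨fun j x => b j x + a j x, fun j => (hb j).add (ha j), ?_⟩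
  filter_upwards [hz, hw] with x h1 h2
  rw [h1, h2, ← Finset.sum_add_distrib]
  simp [add_mul]

theorem mem_sub {n m : ℕ} {g : Fin m → ((Fin n → ℂ) → ℂ)} {h q : (Fin n → ℂ) → ℂ}
    (hq : MemIdealGerm g q) (hm : MemIdealGerm g h) : MemIdealGerm g (fun x => q x - h x) :=
  mem_congr (mem_add hq (mem_mul (q := fun _ => -1) analyticAt_const hm))
    (Eventually.of_forall fun x => by ring)

theorem mem_zero {n m : ℕ} (g : Fin m → ((Fin n → ℂ) → ℂ)) : MemIdealGerm g (fun _ => 0) :=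
  ⟨fun _ _ => 0, fun _ => analyticAt_const, by simp⟩

theorem mem_sum {n m : ℕ} {g : Fin m → ((Fin n → ℂ) → ℂ)} {κ : Type*} (s : Finset κ)
    (h : κ → (Fin n → ℂ) → ℂ) (hm : ∀ k ∈ s, MemIdealGerm g (h k)) :
    MemIdealGerm g (fun x => ∑ k ∈ s, h k x) := by
  classical
  induction s using Finset.induction_on with
  | empty => simpa using mem_zero g
  | insert k s hk ih =>
    simp only [Finset.sum_insert hk]
    exact mem_add (hm k (Finset.mem_insert_self _ _))
      (ih fun k hk => hm k (Finset.mem_insert_of_mem hk))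

end Stm6


namespace Stm6

/-- `α` is the exponent of the leading monomial of some element of the ideal, the normalised
coefficients of which are `a`. -/
def Lead {n m : ℕ} (g : Fin m → ((Fin n → ℂ) → ℂ)) (α : Fin n → ℕ) (a : (Fin n → ℕ) → ℂ) :
    Prop :=
  (∃ σ, Summable fun β => ‖a β‖ * ww σ β) ∧
    MemIdealGerm g (fun x => ∑' β, a β * mon β x) ∧ a α = 1 ∧ ∀ β, NN β < NN α → a β = 0

theorem tail_small {n m : ℕ} {g : Fin m → ((Fin n → ℂ) → ℂ)} {α : Fin n → ℕ}
    {a : (Fin n → ℕ) → ℂ} (h : Lead g α a) :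
    ∀ᶠ σ in atTop, ∃ v : XX n, (∀ β, v β = a β * ww σ β / ww σ α) ∧ ‖v - ee α‖ ≤ 1 / 2 := by
  classical
  obtain ⟨⟨σ₀, hs⟩, -, h1, h0⟩ := h
  set q : ℝ := (NN α : ℝ) / (NN α + 1) with hq
  have hNα : (0 : ℝ) < NN α := by exact_mod_cast NN_pos α
  have hq0 : 0 < q := by positivity
  have hq1 : q < 1 := by rw [hq, div_lt_one (by positivity)]; linarith
  set C : ℝ := ∑' β, ‖a β‖ * ww σ₀ β / ww σ₀ α with hC
  have hsC : Summable fun β => ‖a β‖ * ww σ₀ β / ww σ₀ α := hs.div_const _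
  have hlim : Tendsto (fun τ : ℕ => C * q ^ τ) atTop (𝓝 0) := by
    simpa using (tendsto_pow_atTop_nhds_zero_of_lt_one hq0.le hq1).const_mul C
  have hev : ∀ᶠ τ : ℕ in atTop, C * q ^ τ ≤ 1 / 2 := hlim.eventually (ge_mem_nhds (by norm_num))
  have hev2 : ∀ᶠ σ : ℕ in atTop, C * q ^ (σ - σ₀) ≤ 1 / 2 :=
    (tendsto_sub_atTop_nat σ₀).eventually hev
  filter_upwards [hev2, eventually_ge_atTop σ₀] with σ hσ hσσ
  obtain ⟨τ, rfl⟩ := Nat.exists_eq_add_of_le hσσ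
  rw [Nat.add_sub_cancel_left] at hσ
  have hbd : ∀ β, β ≠ α → ‖a β * ww (σ₀ + τ) β / ww (σ₀ + τ) α‖ ≤
      ‖a β‖ * ww σ₀ β / ww σ₀ α * q ^ τ := by
    intro β hβ
    by_cases hz : a β = 0
    · simp [hz]
    have hlt : NN α < NN β := by
      rcases lt_trichotomy (NN α) (NN β) with h | h | h
      · exact h
      · exact absurd (NN_inj h).symm hβ
      · exact absurd (h0 β h) hz
    have hNβ : (NN α : ℝ) + 1 ≤ NN β := by exact_mod_cast hlt
    have hNβ0 : (0 : ℝ) < NN β := by linarith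
    rw [norm_div, norm_mul, Complex.norm_real, Complex.norm_real,
      Real.norm_of_nonneg (ww_pos _ _).le, Real.norm_of_nonneg (ww_pos _ _).le]
    have e : ‖a β‖ * ww (σ₀ + τ) β / ww (σ₀ + τ) α =
        ‖a β‖ * ww σ₀ β / ww σ₀ α * ((NN α : ℝ) / NN β) ^ τ := by
      simp only [ww, pow_add, div_pow]
      field_simp
    rw [e]
    have : 0 ≤ ‖a β‖ * ww σ₀ β / ww σ₀ α :=
      div_nonneg (mul_nonneg (norm_nonneg _) (ww_pos _ _).le) (ww_pos _ _).le
    have hle : (NN α : ℝ) / NN β ≤ q := by rw [hq]; gcongr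
    gcongr
  have hwα : (ww (σ₀ + τ) α : ℂ) ≠ 0 := by exact_mod_cast (ww_pos _ _).ne'
  obtain ⟨v', hv'⟩ := XX_of_summable
    (fun β => if β = α then 0 else a β * ww (σ₀ + τ) β / ww (σ₀ + τ) α) (by
      refine Summable.of_nonneg_of_le (fun _ => norm_nonneg _) (fun β => ?_)
        (hsC.mul_right (q ^ τ))
      split_ifs with hβ
      · rw [norm_zero]
        exact mul_nonneg (div_nonneg (mul_nonneg (norm_nonneg _) (ww_pos _ _).le)
          (ww_pos _ _).le) (by positivity)
      · exact hbd β hβ)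
  refine ⟨v' + ee α, fun β => ?_, ?_⟩
  · rw [lp.coeFn_add, Pi.add_apply, hv', ee_apply]
    by_cases hβ : β = α
    · subst hβ
      simp [h1, hwα]
    · simp [hβ]
  · rw [add_sub_cancel_right]
    refine le_trans ?_ hσ
    refine hasSum_le (fun β => ?_) (XX_hasSum_norm v') (hsC.hasSum.mul_right (q ^ τ))
    rw [hv']
    split_ifs with hβ
    · rw [norm_zero]
      exact mul_nonneg (div_nonneg (mul_nonneg (norm_nonneg _) (ww_pos _ _).le)
        (ww_pos _ _).le) (by positivity)
    · exact hbd β hβ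

theorem dickson {n : ℕ} (S : Set (Fin n → ℕ)) :
    ∃ B : Finset (Fin n → ℕ), (∀ b ∈ B, b ∈ S) ∧ ∀ α ∈ S, ∃ b ∈ B, b ≤ α := by
  have hfin : {b | Minimal (· ∈ S) b}.Finite :=
    WellQuasiOrderedLE.finite_of_isAntichain (setOfPred_minimal_antichain _)
  refine ⟨hfin.toFinset, fun b hb => ?_, fun α hα => ?_⟩
  · exact ((hfin.mem_toFinset).1 hb).prop
  · obtain ⟨b, hb, hm⟩ := exists_minimal_le_of_wellFoundedLT (· ∈ S) α hα
    exact ⟨b, hfin.mem_toFinset.2 hm, hb⟩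

theorem division {n m : ℕ} (g : Fin m → ((Fin n → ℂ) → ℂ)) :
    ∀ᶠ σ in atTop, ∃ (D : (XX n →L[ℂ] XX n)ˣ) (R : XX n →L[ℂ] XX n),
      (∀ α, (∃ a, Lead g α a) → R (ee α) = 0) ∧ (∀ α, (¬ ∃ a, Lead g α a) → R (ee α) = ee α) ∧
      ∀ u, MemIdealGerm g (fun x => evf σ (D.1 u) x - evf σ (R u) x) := by
  classical
  obtain ⟨B, hB, hB'⟩ := dickson {α | ∃ a, Lead g α a}
  have hch : ∀ b : (Fin n → ℕ), ∃ a, b ∈ B → Lead g b a := by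
    intro b
    by_cases hb : b ∈ B
    · obtain ⟨a, ha⟩ := hB b hb
      exact ⟨a, fun _ => ha⟩
    · exact ⟨0, fun h => absurd h hb⟩
  choose a ha using hch
  have hch2 : ∀ α : (Fin n → ℕ), ∃ b, (∃ a, Lead g α a) → b ∈ B ∧ b ≤ α := by
    intro α
    by_cases hα : ∃ a, Lead g α a
    · obtain ⟨b, hb⟩ := hB' α hα
      exact ⟨b, fun _ => hb⟩
    · exact ⟨0, fun h => absurd h hα⟩
  choose bb hbb using hch2
  have hev : ∀ᶠ σ in atTop, ∀ b ∈ B, ∃ v : XX n, (∀ β, v β = a b β * ww σ β / ww σ b) ∧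
      ‖v - ee b‖ ≤ 1 / 2 := by
    rw [Filter.eventually_all_finset]
    exact fun b hb => tail_small (ha b hb)
  filter_upwards [hev] with σ hσ
  have hch3 : ∀ b : (Fin n → ℕ), ∃ v : XX n, b ∈ B → (∀ β, v β = a b β * ww σ β / ww σ b) ∧
      ‖v - ee b‖ ≤ 1 / 2 := by
    intro b
    by_cases hb : b ∈ B
    · obtain ⟨v, hv⟩ := hσ b hb
      exact ⟨v, fun _ => hv⟩
    · exact ⟨0, fun h => absurd h hb⟩
  choose v hv using hch3
  -- shift operators
  have hT : ∀ δ : Fin n → ℕ, ∃ T : XX n →L[ℂ] XX n, (∀ γ, T (ee γ) = ee (γ + δ)) ∧ ‖T‖ ≤ 1 :=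
    fun δ => exists_op (fun γ => ee (γ + δ)) 1 zero_le_one (fun γ => (norm_ee _).le)
  choose T hT1 hT2 using hT
  -- columns
  obtain ⟨E, hE1, hE2⟩ := exists_op (n := n) (Y := XX n)
    (fun α => if (∃ a, Lead g α a) then T (α - bb α) (ee (bb α) - v (bb α)) else 0) (1 / 2)
    (by norm_num) (fun α => by
      split_ifs with hα
      · refine ((T (α - bb α)).le_opNorm _).trans ?_
        rw [norm_sub_rev]
        calc _ ≤ 1 * (1 / 2 : ℝ) := by
              gcongr
              · exact hT2 _
              · exact (hv _ (hbb α hα).1).2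
          _ = 1 / 2 := by norm_num
      · simp)
  obtain ⟨R, hR1, hR2⟩ := exists_op (n := n) (Y := XX n)
    (fun α => if (∃ a, Lead g α a) then 0 else ee α) 1 zero_le_one (fun α => by
      split_ifs
      · simp
      · exact (norm_ee _).le)
  have hQ : ∀ b : Fin n → ℕ, ∃ Q : XX n →L[ℂ] XX n, ∀ α, Q (ee α) =
      if (∃ a, Lead g α a) ∧ bb α = b then ((ww σ b)⁻¹ : ℂ) • ee (α - b) else 0 := by
    intro b
    obtain ⟨Q, hQ, -⟩ := exists_op (n := n) (Y := XX n) (fun α =>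
      if (∃ a, Lead g α a) ∧ bb α = b then ((ww σ b)⁻¹ : ℂ) • ee (α - b) else 0)
      ‖((ww σ b)⁻¹ : ℂ)‖ (norm_nonneg _) (fun α => by
        split_ifs
        · rw [norm_smul, norm_ee, mul_one]
        · rw [norm_zero]; exact norm_nonneg _)
    exact ⟨Q, hQ⟩
  choose Q hQ using hQ
  refine ⟨Units.oneSub E (lt_of_le_of_lt hE2 (by norm_num)), R, fun α hα => ?_, fun α hα => ?_,
    fun u => ?_⟩
  · rw [hR1, if_pos hα]
  · rw [hR1, if_neg hα]
  · refine mem_congr (h := fun x => ∑ b ∈ B, evf σ (Q b u) x * ∑' β, a b β * mon β x)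
      (mem_sum B _ fun b hb => mem_mul (evf_analyticAt σ _) (ha b hb).2.1) ?_
    filter_upwards [PP_nhds n σ] with x hx
    obtain ⟨L, hL, -, hLev⟩ := exists_ev hx
    rw [← hLev, ← hLev]
    simp only [← hLev]
    have hw : ∀ γ : Fin n → ℕ, (ww σ γ : ℂ) ≠ 0 := fun γ => by exact_mod_cast (ww_pos _ _).ne'
    have hmul : ∀ δ w, L (T δ w) = mon δ x / ww σ δ * L w := by
      intro δ w
      refine XX_ext (L.comp (T δ)) ((mon δ x / ww σ δ) • L) (fun γ => ?_) w
      simp only [ContinuousLinearMap.comp_apply, hT1, hL, smul_apply, smul_eq_mul, mon_add, ww_add]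
      push_cast
      have := hw γ; have := hw δ
      field_simp
    have hLv : ∀ b ∈ B, L (v b) = (∑' β, a b β * mon β x) / ww σ b := by
      intro b hb
      rw [hLev, evf, ← tsum_div_const]
      refine tsum_congr fun β => ?_
      rw [(hv b hb).1]
      have := hw β; have := hw b
      field_simp
    have key := XX_ext (L.comp (1 - E) - L.comp R)
      (∑ b ∈ B, (∑' β, a b β * mon β x) • L.comp (Q b)) (fun α => by
        simp only [sub_apply, ContinuousLinearMap.comp_apply, sum_apply, smul_apply,
          one_apply_eq_self, map_sub, hE1, hR1, hQ, smul_eq_mul]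
        by_cases hα : ∃ a, Lead g α a
        · obtain ⟨hb, hle⟩ := hbb α hα
          simp only [hα, if_true, true_and, map_sub, hmul, map_zero]
          rw [Finset.sum_eq_single (bb α)]
          · rw [if_pos rfl, map_smul, hLv _ hb, hL, hL, hL]
            have e : α = (α - bb α) + bb α := (tsub_add_cancel_of_le hle).symm
            have e1 : mon α x = mon (α - bb α) x * mon (bb α) x := by rw [← mon_add, ← e]
            have e2 : ww σ α = ww σ (α - bb α) * ww σ (bb α) := by rw [← ww_add, ← e]
            rw [e1, e2, smul_eq_mul]
            push_cast
            have := hw (α - bb α); have := hw (bb α)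
            field_simp
            ring
          · intro b _ hne
            rw [if_neg (Ne.symm hne), map_zero, mul_zero]
          · exact fun h => absurd hb h
        · simp [hα]) u
    simp only [sub_apply, ContinuousLinearMap.comp_apply, sum_apply, smul_apply,
      smul_eq_mul] at key
    rw [Units.val_oneSub, sub_apply]
    rw [key]
    exact Finset.sum_congr rfl fun b _ => mul_comm _ _

end Stm6


namespace Stm6

theorem norm_evf_le {n σ : ℕ} {x : Fin n → ℂ} (hx : x ∈ PP n σ) (u : XX n) :
    ‖evf σ u x‖ ≤ ‖u‖ := by
  obtain ⟨L, -, h1, h2⟩ := exists_ev hx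
  rw [← h2]
  exact (L.le_opNorm u).trans (mul_le_of_le_one_left (norm_nonneg _) h1)

theorem expand {n : ℕ} (G : (Fin n → ℂ) × ℂ → ℂ) (hG : AnalyticAt ℂ G 0) :
    ∀ᶠ σ in atTop, ∃ (H : ℕ → XX n) (r : ℝ), 0 < r ∧ Summable (fun j => r ^ j * ‖H j‖) ∧
      ∀ x ∈ PP n σ, ∀ t : ℂ, ‖t‖ ≤ r → HasSum (fun j => t ^ j * evf σ (H j) x) (G (x, t)) := by
  classical
  let b : Option (Fin n) → (Fin n → ℂ) × ℂ := fun o => o.elim (0, 1) (fun i => (Pi.single i 1, 0))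
  obtain ⟨a, r, hr, hs, hx⟩ := exists_expansion G hG b (by
    intro o
    cases o with
    | none => simp [b]
    | some i => simp [b, Prod.norm_def, Pi.norm_single])
  have hlim : Tendsto (fun σ : ℕ => ((2 : ℝ) ^ σ)⁻¹) atTop (𝓝 0) := by
    simpa using tendsto_pow_atTop_nhds_zero_of_lt_one (r := (2 : ℝ)⁻¹) (by norm_num) (by norm_num)
  filter_upwards [hlim.eventually (ge_mem_nhds hr)] with σ hσ
  let e : ℕ × (Fin n → ℕ) ≃ (Option (Fin n) → ℕ) :=
    (Equiv.piOptionEquivProd (β := fun _ : Option (Fin n) => ℕ)).symm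
  have he0 : ∀ j α, e (j, α) none = j := fun _ _ => rfl
  have he1 : ∀ j α i, e (j, α) (some i) = α i := fun _ _ _ => rfl
  have hs2 : Summable fun q : ℕ × (Fin n → ℕ) => r ^ q.1 * (‖a (e q)‖ * ww σ q.2) := by
    refine Summable.of_nonneg_of_le (fun q => ?_) (fun q => ?_) (e.summable_iff.2 hs)
    · have := (ww_pos σ q.2).le
      positivity
    · obtain ⟨j, α⟩ := q
      simp only [Function.comp, Fintype.sum_option, he0, he1, pow_add]
      have := ww_le_pow hσ α
      calc r ^ j * (‖a (e (j, α))‖ * ww σ α) ≤ r ^ j * (‖a (e (j, α))‖ * r ^ (∑ i, α i)) := by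
            gcongr
        _ = _ := by ring
  have hn : ∀ q : ℕ × (Fin n → ℕ), ‖a (e q) * (ww σ q.2 : ℂ)‖ = ‖a (e q)‖ * ww σ q.2 := by
    intro q
    rw [norm_mul, Complex.norm_real, Real.norm_of_nonneg (ww_pos _ _).le]
  have hH : ∀ j, ∃ u : XX n, ∀ α, u α = a (e (j, α)) * ww σ α := by
    intro j
    refine XX_of_summable _ ?_
    have := (hs2.prod_factor j).mul_left ((r ^ j)⁻¹)
    refine this.congr fun α => ?_
    rw [hn (j, α)]
    field_simp
  choose H hH using hH
  refine ⟨H, r, hr, ?_, fun x hxP t ht => ?_⟩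
  · have := hs2.prod
    refine this.congr fun j => ?_
    change ∑' α, r ^ j * (‖a (e (j, α))‖ * ww σ α) = r ^ j * ‖H j‖
    rw [tsum_mul_left, ← (XX_hasSum_norm (H j)).tsum_eq]
    congr 1
    refine tsum_congr fun α => ?_
    rw [hH, hn (j, α)]
  · have hxr : ∀ o : Option (Fin n), ‖(o.elim t x : ℂ)‖ ≤ r := by
      intro o
      cases o with
      | none => exact ht
      | some i =>
        refine (hxP i).trans (le_trans ?_ hσ)
        have : (2 : ℝ) ≤ pr i := by exact_mod_cast (pr_prime i).two_le
        change ((pr i : ℝ) ^ σ)⁻¹ ≤ (2 ^ σ)⁻¹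
        gcongr
    have h := hx (fun o => o.elim t x) hxr
    have hpt : ∑ o : Option (Fin n), (o.elim t x : ℂ) • b o = (x, t) := by
      rw [Fintype.sum_option]
      ext i
      · simp [b, Prod.fst_sum, Finset.sum_apply, Pi.single_apply]
      · simp [b, Prod.snd_sum]
    rw [hpt] at h
    have h2 := e.hasSum_iff.2 h
    have hterm : ∀ q : ℕ × (Fin n → ℕ), a (e q) * mon (e q) (fun o => o.elim t x) =
        t ^ q.1 * ((a (e q)) * mon q.2 x) := by
      rintro ⟨j, α⟩
      have : mon (e (j, α)) (fun o => o.elim t x) = t ^ j * mon α x := by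
        simp [mon, Fintype.prod_option, he0, he1]
      rw [this]; ring
    have h3 : HasSum (fun q : ℕ × (Fin n → ℕ) => t ^ q.1 * ((a (e q)) * mon q.2 x))
        (G (x, t)) := by
      have hfun := funext hterm
      rw [← hfun]
      exact h2
    refine h3.prod_fiberwise fun j => ?_
    have h4 := h3.summable.prod_factor j
    obtain ⟨L, hL, -, hLev⟩ := exists_ev hxP
    have h5 := L.hasSum (hasSum_ee (H j))
    rw [hLev] at h5
    have hfun : (fun α => L ((H j) α • ee α)) = fun α => a (e (j, α)) * mon α x := by
      funext α
      have hw : (ww σ α : ℂ) ≠ 0 := by exact_mod_cast (ww_pos _ _).ne'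
      rw [map_smul, hL, hH, smul_eq_mul]
      field_simp
    rw [hfun] at h5
    exact h5.mul_left (t ^ j)

theorem coeff_eq {n σ : ℕ} (G : (Fin n → ℂ) × ℂ → ℂ) (h : ℕ → ((Fin n → ℂ) → ℂ))
    (hsum : ∀ᶠ p in 𝓝 (0 : (Fin n → ℂ) × ℂ), HasSum (fun j : ℕ => p.2 ^ j * h j p.1) (G p))
    (H : ℕ → XX n) (r : ℝ) (hr : 0 < r)
    (hH : ∀ x ∈ PP n σ, ∀ t : ℂ, ‖t‖ ≤ r → HasSum (fun j => t ^ j * evf σ (H j) x) (G (x, t))) :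
    ∀ᶠ x in 𝓝 (0 : Fin n → ℂ), ∀ j, h j x = evf σ (H j) x := by
  have h1 := Filter.Eventually.curry_nhds (x := (0 : Fin n → ℂ)) (y := (0 : ℂ)) hsum
  filter_upwards [h1, PP_nhds n σ] with x hx hxP j
  refine coeff_unique (fun j => h j x) (fun j => evf σ (H j) x) (fun t => G (x, t)) hx ?_ j
  filter_upwards [closedBall_mem_nhds (0 : ℂ) hr] with t ht
  exact hH x hxP t (by simpa using ht)

theorem main_lemma {n m : ℕ} (g : Fin m → ((Fin n → ℂ) → ℂ))
    (G : (Fin n → ℂ) × ℂ → ℂ) (hG : AnalyticAt ℂ G 0) (h : ℕ → ((Fin n → ℂ) → ℂ))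
    (hsum : ∀ᶠ p in 𝓝 (0 : (Fin n → ℂ) × ℂ), HasSum (fun j : ℕ => p.2 ^ j * h j p.1) (G p))
    (t : ℕ → ℂ) (ht0 : Tendsto t atTop (𝓝 0)) (htne : ∀ k, t k ≠ 0)
    (hmem : ∀ᶠ k in atTop, MemIdealGerm g (fun x => G (x, t k))) (j : ℕ) :
    MemIdealGerm g (h j) := by
  classical
  obtain ⟨σ, ⟨D, R, hR0, hR1, hD⟩, H, r, hr, hHs, hH⟩ := ((division g).and (expand G hG)).exists
  -- coordinates
  have hco : ∀ α, ∃ c : XX n →L[ℂ] ℂ, ∀ u, c u = u α := by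
    intro α
    obtain ⟨c, hc, -⟩ := exists_op (n := n) (Y := ℂ) (fun β => if α = β then 1 else 0) 1
      zero_le_one (fun β => by split_ifs <;> simp)
    refine ⟨c, fun u => ?_⟩
    have h1 := c.hasSum (hasSum_ee u)
    simp only [map_smul, hc, smul_eq_mul, mul_ite, mul_one, mul_zero] at h1
    rw [← h1.tsum_eq, tsum_ite_eq']
  choose co hco using hco
  have hRco0 : ∀ α, (∃ a, Lead g α a) → ∀ u, (R u) α = 0 := by
    intro α hα u
    rw [← hco]
    refine XX_ext ((co α).comp R) 0 (fun β => ?_) u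
    simp only [ContinuousLinearMap.comp_apply, zero_apply]
    by_cases hβ : ∃ a, Lead g β a
    · rw [hR0 β hβ, map_zero]
    · rw [hR1 β hβ, hco, ee_apply, if_neg]
      rintro rfl
      exact hβ hα
  -- remainder in the ideal vanishes
  have hzero : ∀ u, MemIdealGerm g (evf σ (D.1 u)) → R u = 0 := by
    intro u hu
    have hRu : MemIdealGerm g (evf σ (R u)) :=
      mem_congr (mem_sub hu (hD u)) (Eventually.of_forall fun x => by ring)
    by_contra hne
    have hex : ∃ N, ∃ α, NN α = N ∧ (R u) α ≠ 0 := by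
      by_contra hcon
      push Not at hcon
      refine hne (lp.ext (funext fun α => ?_))
      simpa using hcon _ α rfl
    obtain ⟨α, hα, hα0⟩ := Nat.find_spec hex
    have hmin : ∀ β, NN β < NN α → (R u) β = 0 := by
      intro β hβ
      by_contra hcon
      exact Nat.find_min hex (hα ▸ hβ) ⟨β, rfl, hcon⟩
    refine hα0 (hRco0 α ⟨fun β => ((R u) α / ww σ α)⁻¹ * ((R u) β / ww σ β), ?_, ?_, ?_, ?_⟩ u)
    · refine ⟨σ, ?_⟩
      refine ((XX_hasSum_norm (R u)).summable.mul_left ‖((R u) α / ww σ α)⁻¹‖).congr fun β => ?_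
      rw [norm_mul, norm_div _ (ww σ β : ℂ), Complex.norm_real (ww σ β),
        Real.norm_of_nonneg (ww_pos _ _).le]
      have := (ww_pos σ β).ne'
      field_simp
    · refine mem_congr (mem_mul (q := fun _ => ((R u) α / ww σ α)⁻¹) analyticAt_const hRu)
        (Eventually.of_forall fun x => ?_)
      rw [evf, ← tsum_mul_left]
      exact tsum_congr fun β => by ring
    · refine inv_mul_cancel₀ (div_ne_zero hα0 ?_)
      exact_mod_cast (ww_pos _ _).ne'
    · intro β hβ
      simp [hmin β hβ]
  -- the inverse
  let V : XX n →L[ℂ] XX n := (D⁻¹ : (XX n →L[ℂ] XX n)ˣ).1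
  have hDV : ∀ u, D.1 (V u) = u := by
    intro u
    have h1 : D.1 * V = 1 := D.mul_inv
    change (D.1 * V) u = u
    rw [h1]
    rfl
  have hsumX : ∀ s : ℂ, ‖s‖ ≤ r → Summable fun j => s ^ j • H j := by
    intro s hs
    refine Summable.of_norm_bounded hHs fun j => ?_
    rw [norm_smul, norm_pow]
    gcongr
  have hcoef : ∀ α j, (R (V (H j))) α = 0 := by
    intro α
    refine coeff_zero (fun j => (R (V (H j))) α) (fun s => (R (V (∑' j, s ^ j • H j))) α) ?_ ?_
    · filter_upwards [closedBall_mem_nhds (0 : ℂ) hr] with s hs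
      have := ((co α).comp (R.comp V)).hasSum (hsumX s (by simpa using hs)).hasSum
      simpa only [ContinuousLinearMap.comp_apply, map_smul, hco, smul_eq_mul] using this
    · have htt : Tendsto t atTop (𝓝[≠] 0) :=
        tendsto_nhdsWithin_iff.2 ⟨ht0, Eventually.of_forall htne⟩
      refine htt.frequently (Eventually.frequently ?_)
      filter_upwards [hmem, ht0.eventually (closedBall_mem_nhds (0 : ℂ) hr)] with k hk hkr
      have hkr' : ‖t k‖ ≤ r := by simpa using hkr
      rw [hzero]
      · simp
      · refine mem_congr hk ?_
        filter_upwards [PP_nhds n σ] with x hx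
        rw [hDV]
        obtain ⟨L, -, -, hLev⟩ := exists_ev hx
        have h1 := L.hasSum (hsumX (t k) hkr').hasSum
        simp only [map_smul, smul_eq_mul] at h1
        simp only [hLev] at h1
        exact h1.unique (hH x hx _ hkr')
  have hRz : R (V (H j)) = 0 := lp.ext (funext fun α => by simpa using hcoef α j)
  refine mem_congr (hD (V (H j))) ?_
  filter_upwards [coeff_eq G h hsum H r hr hH] with x hx
  rw [hx j, hDV, hRz]
  simp [evf]

theorem final (n m : ℕ) (g : Fin m → ((Fin n → ℂ) → ℂ))
    (F : (Fin n → ℂ) × ℂ → ℂ) (hF : AnalyticAt ℂ F 0)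
    (f : ℕ → ((Fin n → ℂ) → ℂ))
    (hsum : ∀ᶠ p in 𝓝 (0 : (Fin n → ℂ) × ℂ), HasSum (fun j : ℕ => p.2 ^ j * f j p.1) (F p))
    (t : ℕ → ℂ) (ht0 : Tendsto t atTop (𝓝 0)) (htne : ∀ k, t k ≠ 0)
    (i : Fin n)
    (hmem : ∀ k, MemIdealGerm g (fun x => fderiv ℂ (fun y => F (y, t k)) x (Pi.single i 1)))
    (j : ℕ) : MemIdealGerm g (fun x => fderiv ℂ (f j) x (Pi.single i 1)) := by
  obtain ⟨σ, H, r, hr, hHs, hH⟩ := (expand F hF).exists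
  obtain ⟨ρ₀, hρ₀, han⟩ := evf_analytic n σ
  obtain ⟨ρ₁, hρ₁, hb1⟩ := Metric.eventually_nhds_iff_ball.1
    ((coeff_eq F f hsum H r hr hH).and (PP_nhds n σ))
  obtain ⟨ρ₂, hρ₂, hb2⟩ := Metric.eventually_nhds_iff_ball.1 hF.eventually_analyticAt
  set ρ := min ρ₀ (min ρ₁ ρ₂) with hρdef
  have hρ : 0 < ρ := by positivity
  have hle0 : ρ ≤ ρ₀ := min_le_left _ _
  have hle1 : ρ ≤ ρ₁ := (min_le_right _ _).trans (min_le_left _ _)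
  have hle2 : ρ ≤ ρ₂ := (min_le_right _ _).trans (min_le_right _ _)
  have hFan : ∀ x ∈ ball (0 : Fin n → ℂ) ρ, ∀ s ∈ ball (0 : ℂ) ρ, AnalyticAt ℂ F (x, s) := by
    intro x hx s hs
    refine hb2 _ ?_
    rw [mem_ball_zero_iff] at *
    exact (max_lt hx hs).trans_le hle2
  have hslice : ∀ x ∈ ball (0 : Fin n → ℂ) ρ, ∀ s ∈ ball (0 : ℂ) ρ,
      HasFDerivAt (fun y => F (y, s)) ((fderiv ℂ F (x, s)).comp
        (ContinuousLinearMap.inl ℂ (Fin n → ℂ) ℂ)) x := by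
    intro x hx s hs
    exact (hFan x hx s hs).differentiableAt.hasFDerivAt.comp x (hasFDerivAt_prodMk_left x s)
  let G : (Fin n → ℂ) × ℂ → ℂ := fun p => fderiv ℂ F p (Pi.single i 1, 0)
  have hGan : AnalyticAt ℂ G 0 := 
    ((ContinuousLinearMap.apply ℂ ℂ ((Pi.single i 1, 0) : (Fin n → ℂ) × ℂ)).analyticAt _).comp hF.fderiv
  refine main_lemma g G hGan (fun j x => fderiv ℂ (f j) x (Pi.single i 1)) ?_ t ht0 htne ?_ j
  · have hnh : ball (0 : Fin n → ℂ) ρ ×ˢ ball (0 : ℂ) (min ρ r) ∈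
        𝓝 (0 : (Fin n → ℂ) × ℂ) :=
      prod_mem_nhds (ball_mem_nhds _ hρ) (ball_mem_nhds _ (lt_min hρ hr))
    filter_upwards [hnh] with p hp
    obtain ⟨x, s⟩ := p
    obtain ⟨hx, hs⟩ := hp
    simp only at hx hs
    have hsρ : s ∈ ball (0 : ℂ) ρ := ball_subset_ball (min_le_left _ _) hs
    have hsr : ‖s‖ ≤ r := (mem_ball_zero_iff.1 (ball_subset_ball (min_le_right _ _) hs)).le
    let c : ℂ → (Fin n → ℂ) := fun y => x + y • Pi.single i 1
    have hc : Continuous c := by fun_prop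
    have hc0 : c 0 = x := by simp [c]
    let U : Set ℂ := c ⁻¹' ball 0 ρ
    have hU : IsOpen U := isOpen_ball.preimage hc
    have h0U : (0 : ℂ) ∈ U := by
      refine mem_preimage.2 ?_
      rw [hc0]; exact hx
    have key := Complex.hasSum_deriv_of_summable_norm (U := U) (z := 0)
      (F := fun j y => s ^ j * evf σ (H j) (c y)) hHs (fun j y hy => by
        have h1 : DifferentiableAt ℂ (evf σ (H j)) (c y) :=
          (han (H j) _ (ball_subset_ball hle0 hy)).differentiableAt
        have h2 : DifferentiableAt ℂ c y := by fun_prop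
        exact ((h1.comp y h2).const_mul _).differentiableWithinAt) hU
      (fun j y hy => by
        rw [norm_mul, norm_pow]
        gcongr
        exact norm_evf_le (hb1 _ (ball_subset_ball hle1 hy)).2 _) h0U
    have e1 : ∀ j, deriv (fun y => s ^ j * evf σ (H j) (c y)) 0 =
        s ^ j * fderiv ℂ (f j) x (Pi.single i 1) := by
      intro j
      have hloc : f j =ᶠ[𝓝 x] evf σ (H j) := by
        filter_upwards [isOpen_ball.mem_nhds hx] with y hy
        exact (hb1 y (ball_subset_ball hle1 hy)).1 j
      rw [hloc.fderiv_eq]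
      have h1 : HasFDerivAt (evf σ (H j)) _ x :=
        (han (H j) x (ball_subset_ball hle0 hx)).differentiableAt.hasFDerivAt
      have h2 : HasDerivAt (fun y => evf σ (H j) (c y)) _ 0 :=
        h1.hasLineDerivAt (Pi.single i 1)
      exact (h2.const_mul (s ^ j)).deriv
    have e2 : deriv (fun y => ∑' j, s ^ j * evf σ (H j) (c y)) 0 = G (x, s) := by
      have hloc : (fun y => ∑' j, s ^ j * evf σ (H j) (c y)) =ᶠ[𝓝 0] fun y => F (c y, s) := by
        filter_upwards [hU.mem_nhds h0U] with y hy
        exact (hH _ (hb1 _ (ball_subset_ball hle1 hy)).2 s hsr).tsum_eq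
      rw [hloc.deriv_eq]
      have h2 : HasDerivAt (fun y => F (c y, s)) _ 0 :=
        (hslice x hx s hsρ).hasLineDerivAt (Pi.single i 1)
      rw [h2.deriv]
      simp [G]
    simp only [e1, e2] at key
    exact key
  · filter_upwards [ht0.eventually (ball_mem_nhds (0 : ℂ) hρ)] with k hk
    refine mem_congr (hmem k) ?_
    filter_upwards [ball_mem_nhds (0 : Fin n → ℂ) hρ] with x hx
    rw [(hslice x hx (t k) hk).fderiv]
    simp [G]

end Stm6

/-- Let `F(x,t) = Σ_{j≥0} t^j f_j(x)` be a convergent power series near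
`0 ∈ ℂⁿ × ℂ` with all `f_j(0) = 0`, and let `I` be an ideal of holomorphic germs at
`0 ∈ ℂⁿ` (given by generators `g`).  If for every `i` and every member of a sequence
`t_k → 0`, `t_k ≠ 0`, the germ `x ↦ ∂F/∂xᵢ(x, t_k)` lies in `I`, then `∂f_j/∂xᵢ ∈ I`
for every `j ≥ 0` and every `i`. -/
theorem stmt_6 (n m : ℕ) (g : Fin m → ((Fin n → ℂ) → ℂ)) (hg : ∀ j, AnalyticAt ℂ (g j) 0)
    (F : (Fin n → ℂ) × ℂ → ℂ) (hF : AnalyticAt ℂ F 0)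
    (f : ℕ → ((Fin n → ℂ) → ℂ)) (hfan : ∀ j, AnalyticAt ℂ (f j) 0)
    (hf0 : ∀ j, f j 0 = 0)
    (hsum : ∀ᶠ p in 𝓝 (0 : (Fin n → ℂ) × ℂ), HasSum (fun j : ℕ => p.2 ^ j * f j p.1) (F p))
    (t : ℕ → ℂ) (ht0 : Tendsto t atTop (𝓝 0)) (htne : ∀ k, t k ≠ 0)
    (hmem : ∀ k, ∀ i : Fin n,
      MemIdealGerm g (fun x => fderiv ℂ (fun y => F (y, t k)) x (Pi.single i 1))) :
    ∀ j : ℕ, ∀ i : Fin n,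
      MemIdealGerm g (fun x => fderiv ℂ (f j) x (Pi.single i 1)) := by
  intro j i
  exact Stm6.final n m g F hF f hsum t ht0 htne i (fun k => hmem k i) j
end
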